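/- Drift ratio sums at overfitted trees for informed chains: Under the assumptions of the informed-mixing theorem, with probability at least 1 − 4/n − e^{−n/8} over ε ~ N(0, I_n), for every overfitted tree 𝒯 ∈ 𝕋_L with 𝒯 ⊇ 𝒯* and 𝒯 ≠ 𝒯*: Σ_{𝒯̃∈𝒩_p(𝒯)} R₂(𝒯,𝒯̃)P(𝒯,𝒯̃) ≤ −2^{−(L+2)}/(1 + n^{5/2−c}) + n^{1−(A² log n)/8}, and Σ_{𝒯̃∈𝒩_g(𝒯)} R₂(𝒯,𝒯̃)P(𝒯,𝒯̃) ≤ M/n^{c−3/2}, where M = 1 for the informed Bayesian CART and M = 2L for the informed Twiggy Bayesian CART. -/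

import Mathlib

open Finset MeasureTheory Real
open scoped BigOperators NNReal ENNReal

noncomputable section

namespace BayesCART

/-! ## Trees

Nodes of the dyadic (Haar wavelet) tree are encoded by the index `j = 2^l + k`
(the root `ψ_{-1,0}` is `j = 0`, and `ψ_{l,k} ↦ 2^l + k` for `l ≥ 0`, `0 ≤ k < 2^l`).
The children of a node `j ≥ 1` are `2j` and `2j+1`, the unique child of the root `0`
is `1`, and the parent of `j ≥ 1` is `j / 2`.  A tree is identified with the finite
set `S` of its internal nodes, which must contain the root and be ancestor-closed. -/

/-- `S` is the internal-node set of a tree all of whose internal nodes have depth `< L`. -/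
def IsTree (L : ℕ) (S : Finset ℕ) : Prop :=
  0 ∈ S ∧ (∀ j ∈ S, 1 ≤ j → j / 2 ∈ S) ∧ ∀ j ∈ S, j < 2 ^ L

instance (L : ℕ) : DecidablePred (IsTree L) := fun _ => by unfold IsTree; infer_instance

/-- The (finite) collection `𝕋_L` of all trees with internal nodes of depth `< L`. -/
def trees (L : ℕ) : Finset (Finset ℕ) :=
  (Finset.range (2 ^ L)).powerset.filter (IsTree L)

/-- The external (leaf) nodes `𝒯_ext` of the tree with internal nodes `S`. -/
def extSet (S : Finset ℕ) : Finset ℕ :=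
  ((S.image fun j => 2 * j) ∪ S.image fun j => 2 * j + 1).filter fun j => j ∉ S

/-! ## The Haar design -/

/-- The Haar mother wavelet `ψ = 1_{(0,1/2]} − 1_{(1/2,1]}`. -/
def haarMother (x : ℝ) : ℝ :=
  if 0 < x ∧ x ≤ 1 / 2 then 1 else if 1 / 2 < x ∧ x ≤ 1 then -1 else 0

/-- Entry `i` of column `j` of the Haar design matrix with `n` observations at the
design points `x_i = (i+1)/n`: column `j = 0` is `ψ_{-1,0} ≡ 1`, and column
`j = 2^l + k ≥ 1` is `ψ_{lk}(x) = 2^{l/2} ψ(2^l x − k)`. -/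
def haarCol (n j i : ℕ) : ℝ :=
  if j = 0 then 1
  else
    (2 : ℝ) ^ ((Nat.log 2 j : ℝ) / 2) *
      haarMother ((2 : ℝ) ^ (Nat.log 2 j) * ((i + 1 : ℝ) / n) - ((j - 2 ^ Nat.log 2 j : ℕ) : ℝ))

/-- The inner product `X_j' Y` of the `j`-th design column with a vector `Y ∈ ℝⁿ`. -/
def colDot (n : ℕ) (Y : Fin n → ℝ) (j : ℕ) : ℝ := ∑ i : Fin n, haarCol n j i.val * Y i

/-- The vector `X β* = Σ_{j ∈ B} β*_j ψ_j` of values of `f₀` at the design points. -/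
def signalVec (n : ℕ) (β : ℕ → ℝ) (B : Finset ℕ) : Fin n → ℝ :=
  fun i => ∑ j ∈ B, β j * haarCol n j i.val

/-- The response `Y = X β* + ε`. -/
def Yvec (n : ℕ) (β : ℕ → ℝ) (B : Finset ℕ) (ε : Fin n → ℝ) : Fin n → ℝ :=
  fun i => signalVec n β B i + ε i

/-- The standard Gaussian measure of `ε = (ε_1, …, ε_n) ~ N(0, I_n)`. -/
def gauss (n : ℕ) : Measure (Fin n → ℝ) :=
  Measure.pi fun _ => ProbabilityTheory.gaussianReal 0 1

/-! ## Prior and posterior -/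

/-- The split probability `p_{lk} = n^{-c}`. -/
def splitP (n : ℕ) (c : ℝ) : ℝ := (n : ℝ) ^ (-c)

/-- Unnormalized Galton–Watson tree prior `Π(𝒯) ∝ ∏_{int} p ∏_{ext} (1 − p)`
with constant split probability `p`. -/
def priorWt (p : ℝ) (S : Finset ℕ) : ℝ := p ^ S.card * (1 - p) ^ (extSet S).card

/-- The marginal likelihood
`N_Y(𝒯) = (2π)^{-n/2} (1+n)^{-|𝒯_ext|/2} exp{−½ Y'[I − X_𝒯 Σ_𝒯 X_𝒯'] Y}`;
for the orthogonal Haar design (`X'X = nI`) with `Σ_𝒯 = (n/(n+1))(X_𝒯'X_𝒯)^{-1}`,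
`Y' X_𝒯 Σ_𝒯 X_𝒯' Y = (n+1)^{-1} Σ_{j ∈ 𝒯_int} (X_j'Y)²`. -/
def margLik (n : ℕ) (Y : Fin n → ℝ) (S : Finset ℕ) : ℝ :=
  (2 * π) ^ (-(n : ℝ) / 2) * ((1 + n : ℝ) ^ (-((extSet S).card : ℝ) / 2)) *
    Real.exp (-(1 / 2) * ((∑ i, Y i ^ 2) - (1 / ((n : ℝ) + 1)) * ∑ j ∈ S, colDot n Y j ^ 2))

/-- Unnormalized posterior weight `Π(𝒯) N_Y(𝒯)`. -/
def postWt (n : ℕ) (p : ℝ) (Y : Fin n → ℝ) (S : Finset ℕ) : ℝ :=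
  priorWt p S * margLik n Y S

/-- Posterior probability `Π(𝒯 ∣ Y)` of a single tree in `𝕋_L`. -/
def post (L n : ℕ) (p : ℝ) (Y : Fin n → ℝ) (S : Finset ℕ) : ℝ :=
  postWt n p Y S / ∑ T ∈ trees L, postWt n p Y T

/-- Posterior probability of a family of trees. -/
def postSet (L n : ℕ) (p : ℝ) (Y : Fin n → ℝ) (A : Finset (Finset ℕ)) : ℝ :=
  ∑ T ∈ A ∩ trees L, post L n p Y T

/-! ## Assumption 1 -/

/-- Assumption 1: `f₀ = Σ_{(l,k) ∈ ℬ} β*_{lk} ψ_{lk}` with all signal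
coefficients of magnitude in `(A log n / √n, C)`, and `𝒯* ∈ 𝕋_L` is the smallest
tree containing `ℬ` among its internal nodes. -/
structure Assumption1 (L n : ℕ) (A C : ℝ) (β : ℕ → ℝ) (B Sstar : Finset ℕ) : Prop where
  B_depth : ∀ j ∈ B, j < 2 ^ L
  signal_low : ∀ j ∈ B, A * Real.log n / Real.sqrt n < |β j|
  signal_high : ∀ j ∈ B, |β j| < C
  support : ∀ j, j ∉ B → β j = 0
  Sstar_tree : Sstar ∈ trees L
  Sstar_contains : B ⊆ Sstar
  Sstar_min : ∀ T ∈ trees L, B ⊆ T → Sstar ⊆ T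

/-! ## The Bayesian CART proposal -/

/-- GROW candidates: external nodes of depth `< L`. -/
def growCands (L : ℕ) (S : Finset ℕ) : Finset ℕ := (extSet S).filter fun j => j < 2 ^ L

/-- PRUNE candidates: pre-terminal internal nodes (no children internal), root excluded. -/
def pruneCands (S : Finset ℕ) : Finset ℕ :=
  S.filter fun j => j ≠ 0 ∧ 2 * j ∉ S ∧ 2 * j + 1 ∉ S

/-- The GROW/PRUNE proposal kernel of (dyadic) Bayesian CART: GROW and PRUNE are
chosen with probability `1/2` each (with forced moves at the null and the full tree),
a GROW splits a uniformly chosen external node, and a PRUNE collapses a uniformly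
chosen pre-terminal node. -/
def bcartProp (L : ℕ) (S S' : Finset ℕ) : ℝ :=
  (if (pruneCands S).Nonempty then (1 : ℝ) / 2 else 1) *
      (((growCands L S).filter fun j => insert j S = S').card / (growCands L S).card)
    + (if (growCands L S).Nonempty then (1 : ℝ) / 2 else 1) *
      (((pruneCands S).filter fun j => S.erase j = S').card / (pruneCands S).card)

/-! ## Metropolis–Hastings machinery -/

/-- The Metropolis–Hastings transition matrix on `𝕋_L` with target `π₀` and proposal `q`. -/
def mhTrans (L : ℕ) (π₀ : Finset ℕ → ℝ) (q : Finset ℕ → Finset ℕ → ℝ)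
    (S S' : Finset ℕ) : ℝ :=
  if S' = S then
    1 - ∑ T ∈ (trees L).erase S, q S T * min 1 ((π₀ T * q T S) / (π₀ S * q S T))
  else q S S' * min 1 ((π₀ S' * q S' S) / (π₀ S * q S S'))

/-- The lazy modification `(P + I)/2` of a transition matrix. -/
def lazy (P : Finset ℕ → Finset ℕ → ℝ) (S S' : Finset ℕ) : ℝ :=
  (1 / 2) * P S S' + if S' = S then 1 / 2 else 0

/-- `t`-step transition probabilities over the state space `𝕋_L`. -/
def iterP (L : ℕ) (P : Finset ℕ → Finset ℕ → ℝ) : ℕ → Finset ℕ → Finset ℕ → ℝ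
  | 0, S, S' => if S' = S then 1 else 0
  | t + 1, S, S' => ∑ T ∈ trees L, iterP L P t S T * P T S'

/-- Total variation distance `‖P^t(S, ·) − Π(· ∣ Y)‖_TV` between the chain at time `t`
started at `S` and the posterior. -/
def tvDist (L n : ℕ) (p : ℝ) (Y : Fin n → ℝ) (P : Finset ℕ → Finset ℕ → ℝ)
    (t : ℕ) (S : Finset ℕ) : ℝ :=
  (1 / 2) * ∑ T ∈ trees L, |iterP L P t S T - post L n p Y T|

/-- The `ε`-mixing time `τ_ε = max_{𝒯 ∈ 𝕋_L} min{t : Δ_𝒯(t') ≤ ε for all t' ≥ t}`. -/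
def mixTime (L n : ℕ) (p : ℝ) (Y : Fin n → ℝ) (P : Finset ℕ → Finset ℕ → ℝ) (ε : ℝ) : ℕ :=
  sInf {t | ∀ t' ≥ t, ∀ S ∈ trees L, tvDist L n p Y P t' S ≤ ε}

/-- The (non-lazy) Bayesian CART Metropolis–Hastings transition matrix. -/
def bcartP (L n : ℕ) (c : ℝ) (Y : Fin n → ℝ) : Finset ℕ → Finset ℕ → ℝ :=
  mhTrans L (post L n (splitP n c) Y) (bcartProp L)

end BayesCART
namespace BayesCART

/-! ## Twigs and the Twiggy proposal -/

/-- `isAnc a b`: node `a` is a strict ancestor of node `b`. -/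
def isAnc (a b : ℕ) : Prop := ∃ t ∈ Finset.Icc 1 b, b / 2 ^ t = a

instance (a b : ℕ) : Decidable (isAnc a b) := by unfold isAnc; infer_instance

/-- All nodes on the ancestral path from node `j` up to the root (including `j`). -/
def ancPath (j : ℕ) : Finset ℕ := (Finset.range (j + 1)).image fun t => j / 2 ^ t

/-- The tree obtained from `S` by growing, from the closest external node,
the twig ending at the node `j`: the smallest tree containing `S ∪ {j}`. -/
def growTwig (S : Finset ℕ) (j : ℕ) : Finset ℕ := S ∪ ancPath j

/-- The internal descendants of `j` inside the tree `S`. -/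
def descIn (S : Finset ℕ) (j : ℕ) : Finset ℕ := S.filter fun m => isAnc j m

/-- Twiggy PRUNE candidates: non-root internal nodes whose internal descendants
form a twig (a chain in the ancestry order). -/
def twigPruneCands (S : Finset ℕ) : Finset ℕ :=
  S.filter fun j => j ≠ 0 ∧
    ∀ a ∈ descIn S j, ∀ b ∈ descIn S j, a = b ∨ isAnc a b ∨ isAnc b a

/-- The tree obtained by the Twiggy PRUNE at `j`: remove `j` and all of its descendants. -/
def pruneTwig (S : Finset ℕ) (j : ℕ) : Finset ℕ := S \ insert j (descIn S j)

/-- Nodes of layer (depth) `l` missing from `S`. -/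
def layerNodes (S : Finset ℕ) (l : ℕ) : Finset ℕ :=
  (Finset.Ico (2 ^ l) (2 ^ (l + 1))).filter fun j => j ∉ S

/-- Probability `d_{l} = D^{-l} / Σ_{l' ∈ E} D^{-l'}` of picking layer `l` among the
eligible layers. -/
def layerWt (D : ℝ) (L : ℕ) (S : Finset ℕ) (l : ℕ) : ℝ :=
  D ^ (-(l : ℝ)) /
    ∑ l' ∈ (Finset.range L).filter (fun l' => (layerNodes S l').Nonempty), D ^ (-(l' : ℝ))

/-- The Twiggy Bayesian CART proposal kernel: GROW picks a layer with probability
`∝ D^{-l}` then a missing node uniformly within the layer and attaches the whole twig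
to it; PRUNE removes a uniformly chosen twig. -/
def twiggyProp (L : ℕ) (D : ℝ) (S S' : Finset ℕ) : ℝ :=
  (if (twigPruneCands S).Nonempty then (1 : ℝ) / 2 else 1) *
      ∑ l ∈ Finset.range L, layerWt D L S l *
        (((layerNodes S l).filter fun j => growTwig S j = S').card / (layerNodes S l).card)
    + (if ∃ l ∈ Finset.range L, (layerNodes S l).Nonempty then (1 : ℝ) / 2 else 1) *
      (((twigPruneCands S).filter fun j => pruneTwig S j = S').card / (twigPruneCands S).card)

/-- The (non-lazy) Twiggy Bayesian CART Metropolis–Hastings transition matrix. -/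
def twiggyP (L n : ℕ) (c D : ℝ) (Y : Fin n → ℝ) : Finset ℕ → Finset ℕ → ℝ :=
  mhTrans L (post L n (splitP n c) Y) (twiggyProp L D)

/-! ## Locally informed (LIT-MH) proposals -/

/-- GROW neighborhood `𝒩_g(𝒯)` of Bayesian CART: one extra internal node. -/
def bNg (L : ℕ) (S : Finset ℕ) : Finset (Finset ℕ) :=
  (growCands L S).image fun j => insert j S

/-- PRUNE neighborhood `𝒩_p(𝒯)` of Bayesian CART: one internal node removed. -/
def bNp (S : Finset ℕ) : Finset (Finset ℕ) := (pruneCands S).image fun j => S.erase j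

/-- GROW neighborhood of Twiggy Bayesian CART: one extra twig. -/
def tNg (L : ℕ) (S : Finset ℕ) : Finset (Finset ℕ) :=
  (((Finset.range (2 ^ L)).filter fun j => j ∉ S)).image fun j => growTwig S j

/-- PRUNE neighborhood of Twiggy Bayesian CART: one twig removed. -/
def tNp (S : Finset ℕ) : Finset (Finset ℕ) := (twigPruneCands S).image fun j => pruneTwig S j

/-- The posterior ratio `B(𝒯, 𝒯̃) = Π(𝒯̃|Y)/Π(𝒯|Y)`. -/
def postRatio (L n : ℕ) (c : ℝ) (Y : Fin n → ℝ) (S S' : Finset ℕ) : ℝ :=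
  post L n (splitP n c) Y S' / post L n (splitP n c) Y S

/-- Informed GROW weight `w_g(𝒯̃|𝒯) = min{Π(𝒯̃|Y)/Π(𝒯|Y), n^{(A² log n)/8}}`. -/
def wg (L n : ℕ) (c A : ℝ) (Y : Fin n → ℝ) (S S' : Finset ℕ) : ℝ :=
  min (postRatio L n c Y S S') ((n : ℝ) ^ ((A ^ 2 * Real.log n) / 8))

/-- Informed PRUNE weight `w_p(𝒯̃|𝒯) = max{1, min{Π(𝒯̃|Y)/Π(𝒯|Y), n^{c−3/2}}}`. -/
def wp (L n : ℕ) (c : ℝ) (Y : Fin n → ℝ) (S S' : Finset ℕ) : ℝ :=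
  max 1 (min (postRatio L n c Y S S') ((n : ℝ) ^ (c - 3 / 2)))

/-- Normalizing constant `Z_g(𝒯)` of the informed GROW proposal. -/
def Zg (L n : ℕ) (c A : ℝ) (Y : Fin n → ℝ) (Ng : Finset ℕ → Finset (Finset ℕ))
    (S : Finset ℕ) : ℝ := ∑ T ∈ Ng S, wg L n c A Y S T

/-- Normalizing constant `Z_p(𝒯)` of the informed PRUNE proposal. -/
def Zp (L n : ℕ) (c : ℝ) (Y : Fin n → ℝ) (Np : Finset ℕ → Finset (Finset ℕ))
    (S : Finset ℕ) : ℝ := ∑ T ∈ Np S, wp L n c Y S T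

/-- The locally informed (LIT-MH) proposal with neighborhoods `Ng`, `Np`. -/
def infProp (L n : ℕ) (c A : ℝ) (Y : Fin n → ℝ)
    (Ng Np : Finset ℕ → Finset (Finset ℕ)) (S S' : Finset ℕ) : ℝ :=
  (1 / 2) * (if S' ∈ Ng S then wg L n c A Y S S' / Zg L n c A Y Ng S else 0)
    + (1 / 2) * (if S' ∈ Np S then wp L n c Y S S' / Zp L n c Y Np S else 0)

/-- The informed Bayesian CART Metropolis–Hastings transition matrix. -/
def infBcartP (L n : ℕ) (c A : ℝ) (Y : Fin n → ℝ) : Finset ℕ → Finset ℕ → ℝ :=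
  mhTrans L (post L n (splitP n c) Y) (infProp L n c A Y (bNg L) bNp)

/-- The informed Twiggy Bayesian CART Metropolis–Hastings transition matrix. -/
def infTwiggyP (L n : ℕ) (c A : ℝ) (Y : Fin n → ℝ) : Finset ℕ → Finset ℕ → ℝ :=
  mhTrans L (post L n (splitP n c) Y) (infProp L n c A Y (tNg L) tNp)

/-! ## Drift functions -/

/-- The first drift function
`V₁(𝒯) = exp{(2^L (C+2)² (n+1))^{-1} · Y'(I − P_𝒯/n)Y}`, where
`Y' P_𝒯 Y = Σ_{j ∈ 𝒯_int} (X_j'Y)²` for the orthogonal Haar design. -/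
def V1 (L n : ℕ) (C : ℝ) (Y : Fin n → ℝ) (S : Finset ℕ) : ℝ :=
  Real.exp ((1 / (2 ^ L * (C + 2) ^ 2 * ((n : ℝ) + 1))) *
    ((∑ i, Y i ^ 2) - (1 / (n : ℝ)) * ∑ j ∈ S, colDot n Y j ^ 2))

/-- The second drift function
`V₂(𝒯) = exp{2^{-L}(|𝒯_int ∖ 𝒯*_int| + min(|𝒯*_int ∖ 𝒯_int|,1)·(2^L − |𝒯_int ∪ 𝒯*_int|))}`. -/
def V2 (L : ℕ) (Sstar S : Finset ℕ) : ℝ :=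
  Real.exp ((1 / 2 ^ L) * (((S \ Sstar).card : ℝ) +
    min (((Sstar \ S).card : ℝ)) 1 * ((2 ^ L : ℝ) - ((S ∪ Sstar).card : ℝ))))

/-- Drift ratio `R(𝒯, 𝒯̃) = V(𝒯̃)/V(𝒯) − 1`. -/
def driftR (V : Finset ℕ → ℝ) (S S' : Finset ℕ) : ℝ := V S' / V S - 1

/-- `(PV)(𝒯) = Σ_{𝒯̃ ∈ 𝕋_L} V(𝒯̃) P(𝒯, 𝒯̃)`. -/
def PV (L : ℕ) (P : Finset ℕ → Finset ℕ → ℝ) (V : Finset ℕ → ℝ) (S : Finset ℕ) : ℝ :=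
  ∑ T ∈ trees L, V T * P S T

/-! ## Canonical paths -/

/-- The Bayesian CART canonical transition map `𝒢` toward `𝒯*`: if the tree has
redundant internal nodes, remove the deepest rightmost one (maximal `j = 2^l + k`);
otherwise (when `𝒯 ⊂ 𝒯*`) add the deepest rightmost external node lying in `𝒯*_int`. -/
def gMap (Sstar S : Finset ℕ) : Finset ℕ :=
  if S = Sstar then S
  else
    match (S \ Sstar).max with
    | some j => S.erase j
    | none =>
      match ((extSet S) ∩ Sstar).max with
      | some j => insert j S
      | none => S

/-- The Twiggy canonical transition map toward `𝒯*`: if the tree has redundant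
internal nodes, remove the shallowest leftmost one whose internal descendants form a
twig, together with its whole twig of descendants; otherwise grow the twig toward the
deepest rightmost node of `𝒯*_int` missing from `𝒯`. -/
def gTwig (Sstar S : Finset ℕ) : Finset ℕ :=
  if S = Sstar then S
  else
    match ((S \ Sstar).filter fun j =>
        ∀ a ∈ descIn S j, ∀ b ∈ descIn S j, a = b ∨ isAnc a b ∨ isAnc b a).min with
    | some j => pruneTwig S j
    | none =>
      match (Sstar \ S).max with
      | some j => growTwig S j
      | none => S

/-- The set of states on the canonical path from `S` to `𝒯*` (iterating the
transition map `g`; `g` fixes `𝒯*`, and the fuel `2^(2L+2)` is ample). -/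
def pathStates (L : ℕ) (g : Finset ℕ → Finset ℕ) (S : Finset ℕ) : Finset (Finset ℕ) :=
  (Finset.range (2 ^ (2 * L + 2) + 1)).image fun t => g^[t] S

/-- The length `|T_{𝒯,𝒯'}|` of the collapsed canonical path between `𝒯` and `𝒯'`:
the number of states of either path to `𝒯*` that are not on the other path. -/
def pathLen (L : ℕ) (g : Finset ℕ → Finset ℕ) (S S' : Finset ℕ) : ℕ :=
  (pathStates L g S \ pathStates L g S').card + (pathStates L g S' \ pathStates L g S).card

/-- The directed edges traversed by the canonical path from `S` to `𝒯*`. -/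
def pathEdges (L : ℕ) (g : Finset ℕ → Finset ℕ) (S : Finset ℕ) :
    Finset (Finset ℕ × Finset ℕ) :=
  ((Finset.range (2 ^ (2 * L + 2))).image fun t => (g^[t] S, g^[t + 1] S)).filter
    fun e => e.1 ≠ e.2

/-- The edge `e` lies on the collapsed canonical path `T_{𝒯,𝒯'}` (in the forward
direction along `T_{𝒯,𝒯*}`, or backward along `T_{𝒯',𝒯*}`), the common portion of
the two paths being removed. -/
def onPath (L : ℕ) (g : Finset ℕ → Finset ℕ) (e : Finset ℕ × Finset ℕ)
    (S S' : Finset ℕ) : Prop :=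
  (e ∈ pathEdges L g S ∧ e ∉ pathEdges L g S') ∨
    (e.swap ∈ pathEdges L g S' ∧ e.swap ∉ pathEdges L g S)

instance (L : ℕ) (g : Finset ℕ → Finset ℕ) (e : Finset ℕ × Finset ℕ) (S S' : Finset ℕ) :
    Decidable (onPath L g e S S') := by unfold onPath; infer_instance

end BayesCART

namespace BayesCART

/-! ## Orthogonality of the Haar design -/

/-- The sign of the Haar column `j` at the heap leaf `a`, read off at height `s`. -/
def heapSign (s j a : ℕ) : ℝ :=
  if a / 2 ^ s = 2 * j then 1 else if a / 2 ^ s = 2 * j + 1 then -1 else 0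

lemma haarCol_eq_heapSign (l s j i : ℕ) (hl : 2 ^ l ≤ j) (hl' : j < 2 ^ (l + 1)) :
    haarCol (2 ^ (l + 1 + s)) j i
      = (2 : ℝ) ^ ((l : ℝ) / 2) * heapSign s j (2 ^ (l + 1 + s) + i) := by
  have hj : j ≠ 0 := by
    have : 0 < 2 ^ l := by positivity
    omega
  have hlog : Nat.log 2 j = l := (Nat.log_eq_iff (Or.inr ⟨by norm_num, hj⟩)).2 ⟨hl, hl'⟩
  obtain ⟨k, rfl⟩ := Nat.exists_eq_add_of_le hl
  unfold haarCol heapSign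
  rw [if_neg hj, hlog, Nat.add_sub_cancel_left]
  congr 1
  have hs : (0 : ℝ) < 2 ^ s := by positivity
  have hx : (2 : ℝ) ^ l * ((i + 1 : ℝ) / ((2 ^ (l + 1 + s) : ℕ) : ℝ)) - (k : ℝ)
      = ((i + 1 : ℝ) - 2 * k * 2 ^ s) / (2 * 2 ^ s) := by
    push_cast
    rw [pow_add, pow_add]
    field_simp
  have hdiv : (2 ^ (l + 1 + s) + i) / 2 ^ s = 2 ^ (l + 1) + i / 2 ^ s := by
    rw [pow_add _ (l + 1) s, Nat.mul_comm, Nat.mul_add_div (by positivity)]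
  have h0 : ((2 ^ (l + 1 + s) + i) / 2 ^ s = 2 * (2 ^ l + k)) ↔
      2 * k * 2 ^ s ≤ i ∧ i < 2 * k * 2 ^ s + 2 ^ s := by
    rw [hdiv, pow_succ, show 2 ^ l * 2 + i / 2 ^ s = 2 * (2 ^ l + k) ↔ i / 2 ^ s = 2 * k by omega,
      Nat.div_eq_iff (by positivity)]
    have : 0 < 2 ^ s := by positivity
    omega
  have h1 : ((2 ^ (l + 1 + s) + i) / 2 ^ s = 2 * (2 ^ l + k) + 1) ↔
      2 * k * 2 ^ s + 2 ^ s ≤ i ∧ i < 2 * k * 2 ^ s + 2 ^ s + 2 ^ s := by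
    rw [hdiv, pow_succ,
      show 2 ^ l * 2 + i / 2 ^ s = 2 * (2 ^ l + k) + 1 ↔ i / 2 ^ s = 2 * k + 1 by omega,
      Nat.div_eq_iff (by positivity), add_mul, one_mul]
    have : 0 < 2 ^ s := by positivity
    omega
  rw [hx, haarMother]
  have c0 : (0 < ((i + 1 : ℝ) - 2 * k * 2 ^ s) / (2 * 2 ^ s)) ↔ 2 * k * 2 ^ s ≤ i := by
    rw [div_pos_iff_of_pos_right (by positivity), sub_pos]
    rw [← Nat.lt_succ_iff]
    exact_mod_cast Iff.rfl
  have c1 : (((i + 1 : ℝ) - 2 * k * 2 ^ s) / (2 * 2 ^ s) ≤ 1 / 2) ↔ i < 2 * k * 2 ^ s + 2 ^ s := by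
    rw [div_le_iff₀ (by positivity), sub_le_iff_le_add,
      show (1 : ℝ) / 2 * (2 * 2 ^ s) + 2 * k * 2 ^ s = 2 * k * 2 ^ s + 2 ^ s by ring,
      ← Nat.add_one_le_iff]
    exact_mod_cast Iff.rfl
  have c2 : (((i + 1 : ℝ) - 2 * k * 2 ^ s) / (2 * 2 ^ s) ≤ 1) ↔
      i < 2 * k * 2 ^ s + 2 ^ s + 2 ^ s := by
    rw [div_le_iff₀ (by positivity), sub_le_iff_le_add,
      show (1 : ℝ) * (2 * 2 ^ s) + 2 * k * 2 ^ s = 2 * k * 2 ^ s + 2 ^ s + 2 ^ s by ring,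
      ← Nat.add_one_le_iff]
    exact_mod_cast Iff.rfl
  have c3 : (1 / 2 < ((i + 1 : ℝ) - 2 * k * 2 ^ s) / (2 * 2 ^ s)) ↔ 2 * k * 2 ^ s + 2 ^ s ≤ i := by
    rw [← not_le, c1, not_lt]
  simp only [c0, c1, c2, c3, h0, h1]

lemma sum_heap_indicator (l s q : ℕ) (h1 : 2 ^ (l + 1) ≤ q) (h2 : q < 2 ^ (l + 2)) :
    ∑ i ∈ Finset.range (2 ^ (l + 1 + s)),
      (if (2 ^ (l + 1 + s) + i) / 2 ^ s = q then (1 : ℝ) else 0) = 2 ^ s := by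
  rw [Finset.sum_boole]
  have hs : 0 < 2 ^ s := by positivity
  have hb1 : 2 ^ (l + 1 + s) ≤ q * 2 ^ s := by rw [pow_add]; exact Nat.mul_le_mul_right _ h1
  have hb2 : q * 2 ^ s + 2 ^ s ≤ 2 * 2 ^ (l + 1 + s) := by
    have : (q + 1) * 2 ^ s ≤ 2 ^ (l + 2) * 2 ^ s := Nat.mul_le_mul_right _ h2
    calc q * 2 ^ s + 2 ^ s = (q + 1) * 2 ^ s := by ring
      _ ≤ 2 ^ (l + 2) * 2 ^ s := this
      _ = 2 * 2 ^ (l + 1 + s) := by ring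
  have : (Finset.range (2 ^ (l + 1 + s))).filter (fun i => (2 ^ (l + 1 + s) + i) / 2 ^ s = q)
      = Finset.Ico (q * 2 ^ s - 2 ^ (l + 1 + s)) (q * 2 ^ s + 2 ^ s - 2 ^ (l + 1 + s)) := by
    ext i
    rw [Finset.mem_filter, Finset.mem_range, Finset.mem_Ico, Nat.div_eq_iff hs]
    omega
  rw [this, Nat.card_Ico]
  have : q * 2 ^ s + 2 ^ s - 2 ^ (l + 1 + s) - (q * 2 ^ s - 2 ^ (l + 1 + s)) = 2 ^ s := by omega
  rw [this]
  push_cast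
  rfl

lemma sum_heapSign (l s j : ℕ) (hl : 2 ^ l ≤ j) (hl' : j < 2 ^ (l + 1)) :
    ∑ i ∈ Finset.range (2 ^ (l + 1 + s)), heapSign s j (2 ^ (l + 1 + s) + i) = 0 := by
  have e : ∀ a, heapSign s j a = (if a / 2 ^ s = 2 * j then (1 : ℝ) else 0)
      - (if a / 2 ^ s = 2 * j + 1 then (1 : ℝ) else 0) := by
    intro a; unfold heapSign; split_ifs <;> first | omega | norm_num
  have e1 : 2 ^ (l + 1) = 2 * 2 ^ l := by ring
  have e2 : 2 ^ (l + 2) = 2 * 2 ^ (l + 1) := by ring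
  simp only [e, Finset.sum_sub_distrib]
  rw [sum_heap_indicator l s _ (by omega) (by omega),
    sum_heap_indicator l s _ (by omega) (by omega), sub_self]

lemma sum_heapSign_sq (l s j : ℕ) (hl : 2 ^ l ≤ j) (hl' : j < 2 ^ (l + 1)) :
    ∑ i ∈ Finset.range (2 ^ (l + 1 + s)), heapSign s j (2 ^ (l + 1 + s) + i) ^ 2
      = 2 ^ (s + 1) := by
  have e : ∀ a, heapSign s j a ^ 2 = (if a / 2 ^ s = 2 * j then (1 : ℝ) else 0)
      + (if a / 2 ^ s = 2 * j + 1 then (1 : ℝ) else 0) := by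
    intro a; unfold heapSign; split_ifs <;> first | omega | norm_num
  have e1 : 2 ^ (l + 1) = 2 * 2 ^ l := by ring
  have e2 : 2 ^ (l + 2) = 2 * 2 ^ (l + 1) := by ring
  simp only [e, Finset.sum_add_distrib]
  rw [sum_heap_indicator l s _ (by omega) (by omega),
    sum_heap_indicator l s _ (by omega) (by omega)]
  ring

lemma heapSign_eq_zero {s j a : ℕ} (h : a / 2 ^ (s + 1) ≠ j) : heapSign s j a = 0 := by
  have : a / 2 ^ (s + 1) = a / 2 ^ s / 2 := by rw [pow_succ, Nat.div_div_eq_div_mul]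
  rw [this] at h
  unfold heapSign
  rw [if_neg (by omega), if_neg (by omega)]

lemma heapSign_mul_const (s d j j' a : ℕ) :
    heapSign (s + 1 + d) j a * heapSign s j' a
      = heapSign (s + 1 + d) j (j' * 2 ^ (s + 1)) * heapSign s j' a := by
  by_cases h : a / 2 ^ (s + 1) = j'
  · congr 1
    unfold heapSign
    have : a / 2 ^ (s + 1 + d) = j' * 2 ^ (s + 1) / 2 ^ (s + 1 + d) := by
      rw [pow_add _ (s + 1), ← Nat.div_div_eq_div_mul, h, ← Nat.div_div_eq_div_mul,
        Nat.mul_div_cancel _ (by positivity)]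
    rw [this]
  · rw [heapSign_eq_zero h, mul_zero, mul_zero]

lemma exists_level {M j : ℕ} (hj : j ≠ 0) (hM : j < 2 ^ M) :
    ∃ l s, M = l + 1 + s ∧ 2 ^ l ≤ j ∧ j < 2 ^ (l + 1) := by
  have := Nat.log_lt_of_lt_pow hj hM
  exact ⟨Nat.log 2 j, M - (Nat.log 2 j + 1), by omega, Nat.pow_log_le_self 2 hj,
    Nat.lt_pow_succ_log_self (by norm_num) j⟩

lemma sum_haarCol_sq (M j : ℕ) (hM : j < 2 ^ M) :
    ∑ i ∈ Finset.range (2 ^ M), haarCol (2 ^ M) j i ^ 2 = 2 ^ M := by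
  by_cases hj : j = 0
  · subst hj; simp [haarCol]
  · obtain ⟨l, s, rfl, h1, h2⟩ := exists_level hj hM
    simp only [haarCol_eq_heapSign l s j _ h1 h2, mul_pow, ← Finset.mul_sum,
      sum_heapSign_sq l s j h1 h2]
    rw [← Real.rpow_natCast ((2 : ℝ) ^ ((l : ℝ) / 2)) 2, ← Real.rpow_mul (by norm_num)]
    push_cast
    rw [div_mul_cancel₀ _ (by norm_num), Real.rpow_natCast]
    ring

lemma sum_haarCol_mul_of_lt (M j j' : ℕ) (hM : j' < 2 ^ M) (hjj : j < j') :
    ∑ i ∈ Finset.range (2 ^ M), haarCol (2 ^ M) j i * haarCol (2 ^ M) j' i = 0 := by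
  obtain ⟨l', s', hM', h1', h2'⟩ := exists_level (by omega) hM
  have e' : ∀ i, haarCol (2 ^ M) j' i = (2 : ℝ) ^ ((l' : ℝ) / 2) * heapSign s' j' (2 ^ M + i) := by
    intro i; rw [hM', haarCol_eq_heapSign l' s' j' _ h1' h2']
  have hsum : ∑ i ∈ Finset.range (2 ^ M), heapSign s' j' (2 ^ M + i) = 0 := by
    rw [hM', sum_heapSign l' s' j' h1' h2']
  by_cases hj : j = 0
  · subst hj
    have e0 : ∀ i, haarCol (2 ^ M) 0 i = 1 := fun i => by simp [haarCol]
    simp only [e', e0, one_mul, ← Finset.mul_sum, hsum, mul_zero]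
  · obtain ⟨l, s, hM2, h1, h2⟩ := exists_level hj (hjj.trans hM)
    have e : ∀ i, haarCol (2 ^ M) j i = (2 : ℝ) ^ ((l : ℝ) / 2) * heapSign s j (2 ^ M + i) := by
      intro i; rw [hM2, haarCol_eq_heapSign l s j _ h1 h2]
    simp only [e, e']
    have hll : l ≤ l' := by
      by_contra hcon
      have : 2 ^ (l' + 1) ≤ 2 ^ l := Nat.pow_le_pow_right (by norm_num) (by omega)
      omega
    rcases hll.eq_or_lt with rfl | hlt
    · obtain rfl : s = s' := by omega
      refine Finset.sum_eq_zero fun i _ => ?_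
      by_cases h : (2 ^ M + i) / 2 ^ (s + 1) = j
      · rw [heapSign_eq_zero (j := j') (by omega)]; ring
      · rw [heapSign_eq_zero h]; ring
    · obtain ⟨d, rfl⟩ : ∃ d, s = s' + 1 + d := ⟨s - (s' + 1), by omega⟩
      have : ∀ i, (2 : ℝ) ^ ((l : ℝ) / 2) * heapSign (s' + 1 + d) j (2 ^ M + i)
          * ((2 : ℝ) ^ ((l' : ℝ) / 2) * heapSign s' j' (2 ^ M + i))
          = ((2 : ℝ) ^ ((l : ℝ) / 2) * (2 : ℝ) ^ ((l' : ℝ) / 2)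
            * heapSign (s' + 1 + d) j (j' * 2 ^ (s' + 1))) * heapSign s' j' (2 ^ M + i) := by
        intro i
        have := heapSign_mul_const s' d j j' (2 ^ M + i)
        linear_combination ((2 : ℝ) ^ ((l : ℝ) / 2) * (2 : ℝ) ^ ((l' : ℝ) / 2)) * this
      simp only [this, ← Finset.mul_sum, hsum, mul_zero]

lemma sum_haarCol_mul (M j j' : ℕ) (hj : j < 2 ^ M) (hj' : j' < 2 ^ M) :
    ∑ i ∈ Finset.range (2 ^ M), haarCol (2 ^ M) j i * haarCol (2 ^ M) j' i
      = if j' = j then 2 ^ M else 0 := by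
  rcases lt_trichotomy j j' with h | rfl | h
  · rw [if_neg (by omega), sum_haarCol_mul_of_lt M j j' hj' h]
  · simp only [if_true, ← pow_two, sum_haarCol_sq M j hj]
  · simp only [if_neg h.ne, mul_comm (haarCol (2 ^ M) j _), sum_haarCol_mul_of_lt M j' j hj h]

lemma colDot_Yvec (M j : ℕ) (β : ℕ → ℝ) (B : Finset ℕ) (ε : Fin (2 ^ M) → ℝ) (hj : j < 2 ^ M)
    (hB : ∀ b ∈ B, b < 2 ^ M) (hβ : ∀ b, b ∉ B → β b = 0) :
    colDot (2 ^ M) (Yvec (2 ^ M) β B ε) j = 2 ^ M * β j + colDot (2 ^ M) ε j := by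
  unfold colDot Yvec signalVec
  simp only [mul_add, Finset.sum_add_distrib]
  congr 1
  calc ∑ i : Fin (2 ^ M), haarCol (2 ^ M) j i * ∑ b ∈ B, β b * haarCol (2 ^ M) b i
      = ∑ b ∈ B, β b * ∑ i ∈ Finset.range (2 ^ M), haarCol (2 ^ M) j i * haarCol (2 ^ M) b i := by
        rw [Fin.sum_univ_eq_sum_range
          (fun i => haarCol (2 ^ M) j i * ∑ b ∈ B, β b * haarCol (2 ^ M) b i)]
        simp only [Finset.mul_sum]
        rw [Finset.sum_comm]
        exact Finset.sum_congr rfl fun b _ => Finset.sum_congr rfl fun i _ => by ring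
    _ = ∑ b ∈ B, if b = j then β b * 2 ^ M else 0 := by
        refine Finset.sum_congr rfl fun b hb => ?_
        rw [sum_haarCol_mul M j b hj (hB b hb), mul_ite, mul_zero]
    _ = 2 ^ M * β j := by
        rw [Finset.sum_ite_eq']
        split_ifs with h
        · ring
        · rw [hβ j h]; ring

/-! ## The noise event -/

open ProbabilityTheory in
lemma hasSubgaussianMGF_colDot (M j : ℕ) (hj : j < 2 ^ M) :
    HasSubgaussianMGF (fun ε => colDot (2 ^ M) ε j) (2 ^ M) (gauss (2 ^ M)) := by
  have hid : HasSubgaussianMGF (fun x : ℝ => x) 1 (gaussianReal 0 1) :=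
    ⟨fun t => integrable_exp_mul_gaussianReal t, fun t => by rw [mgf_fun_id_gaussianReal]; simp⟩
  have hcoord : ∀ i : Fin (2 ^ M),
      HasSubgaussianMGF (fun ε : Fin (2 ^ M) → ℝ => ε i) 1 (gauss (2 ^ M)) := by
    intro i
    have hmp : MeasurePreserving (Function.eval i) (gauss (2 ^ M)) (gaussianReal 0 1) :=
      measurePreserving_eval (fun _ : Fin (2 ^ M) => gaussianReal 0 1) i
    have := hid
    rw [← hmp.map_eq] at this
    exact this.of_map hmp.measurable.aemeasurable
  have hind : iIndepFun (fun (i : Fin (2 ^ M)) (ε : Fin (2 ^ M) → ℝ) =>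
      haarCol (2 ^ M) j i * ε i) (gauss (2 ^ M)) :=
    iIndepFun_pi (μ := fun _ : Fin (2 ^ M) => gaussianReal 0 1)
      (X := fun i x => haarCol (2 ^ M) j i * x) fun i => (by fun_prop)
  have hscaled : ∀ i : Fin (2 ^ M), HasSubgaussianMGF (fun ε : Fin (2 ^ M) → ℝ =>
      haarCol (2 ^ M) j i * ε i) (Real.toNNReal (haarCol (2 ^ M) j i ^ 2)) (gauss (2 ^ M)) := by
    intro i
    have h := (hcoord i).const_mul (haarCol (2 ^ M) j i)
    convert h using 1
    exact (Real.toNNReal_of_nonneg (sq_nonneg _)).trans (mul_one _).symm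
  have h := HasSubgaussianMGF.sum_of_iIndepFun (s := Finset.univ) hind fun i _ => hscaled i
  have hvar : ∑ i : Fin (2 ^ M), Real.toNNReal (haarCol (2 ^ M) j i ^ 2) = 2 ^ M := by
    apply NNReal.coe_injective
    push_cast
    rw [← sum_haarCol_sq M j hj, ← Fin.sum_univ_eq_sum_range (fun i => haarCol (2 ^ M) j i ^ 2)]
    exact Finset.sum_congr rfl fun i _ => Real.coe_toNNReal _ (sq_nonneg _)
  rw [hvar] at h
  exact h

lemma gauss_colDot_sq_gt (M j : ℕ) (hj : j < 2 ^ M) :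
    gauss (2 ^ M) {ε | 4 * 2 ^ M * Real.log (2 ^ M) < colDot (2 ^ M) ε j ^ 2}
      ≤ ENNReal.ofReal (2 / (2 ^ M) ^ 2) := by
  have : IsProbabilityMeasure (gauss (2 ^ M)) := by unfold gauss; infer_instance
  have hn : (0 : ℝ) < 2 ^ M := by positivity
  have hlog : 0 ≤ Real.log (2 ^ M) := Real.log_nonneg (one_le_pow₀ (by norm_num))
  set t := Real.sqrt (4 * 2 ^ M * Real.log (2 ^ M)) with ht
  have ht0 : 0 ≤ t := Real.sqrt_nonneg _
  have ht2 : t ^ 2 = 4 * 2 ^ M * Real.log (2 ^ M) := Real.sq_sqrt (by positivity)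
  have hexp : Real.exp (-t ^ 2 / (2 * ((2 ^ M : ℝ≥0) : ℝ))) = 1 / (2 ^ M) ^ 2 := by
    rw [ht2]
    push_cast
    rw [show -(4 * 2 ^ M * Real.log (2 ^ M)) / (2 * 2 ^ M) = -(2 * Real.log (2 ^ M)) by
      rw [div_eq_iff (by positivity)]; ring, Real.exp_neg, two_mul, Real.exp_add, Real.exp_log hn]
    rw [one_div, sq]
  have h1 := (hasSubgaussianMGF_colDot M j hj).measure_ge_le ht0
  have h2 := (hasSubgaussianMGF_colDot M j hj).neg.measure_ge_le ht0
  rw [hexp] at h1 h2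
  have hsub : {ε | 4 * 2 ^ M * Real.log (2 ^ M) < colDot (2 ^ M) ε j ^ 2}
      ⊆ {ε | t ≤ colDot (2 ^ M) ε j} ∪ {ε | t ≤ (-fun ε => colDot (2 ^ M) ε j) ε} := by
    intro ε hε
    rw [Set.mem_ofPred_eq, ← ht2] at hε
    by_contra hcon
    simp only [Set.mem_union, Set.mem_ofPred_eq, not_or, not_le, Pi.neg_apply] at hcon
    nlinarith [hcon.1, hcon.2]
  rw [← ofReal_measureReal]
  refine ENNReal.ofReal_le_ofReal ?_
  calc _ ≤ _ := measureReal_mono hsub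
    _ ≤ _ := measureReal_union_le _ _
    _ ≤ 1 / (2 ^ M) ^ 2 + 1 / (2 ^ M) ^ 2 := add_le_add h1 h2
    _ = 2 / (2 ^ M) ^ 2 := by ring

lemma gauss_noise_event (M : ℕ) :
    ENNReal.ofReal (1 - 2 / 2 ^ M) ≤ gauss (2 ^ M)
      {ε | ∀ j < 2 ^ M, colDot (2 ^ M) ε j ^ 2 ≤ 4 * 2 ^ M * Real.log (2 ^ M)} := by
  have : IsProbabilityMeasure (gauss (2 ^ M)) := by unfold gauss; infer_instance
  set G := {ε : Fin (2 ^ M) → ℝ |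
    ∀ j < 2 ^ M, colDot (2 ^ M) ε j ^ 2 ≤ 4 * 2 ^ M * Real.log (2 ^ M)} with hG
  have hn : (0 : ℝ) < 2 ^ M := by positivity
  have hc : gauss (2 ^ M) Gᶜ ≤ ENNReal.ofReal (2 / 2 ^ M) := by
    have hsub : Gᶜ ⊆ ⋃ j ∈ Finset.range (2 ^ M),
        {ε | 4 * 2 ^ M * Real.log (2 ^ M) < colDot (2 ^ M) ε j ^ 2} := by
      intro ε hε
      simp only [hG, Set.mem_compl_iff, Set.mem_ofPred_eq, not_forall, not_le] at hε
      obtain ⟨j, hj, h⟩ := hε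
      exact Set.mem_biUnion (Finset.mem_coe.2 (Finset.mem_range.2 hj)) h
    calc gauss (2 ^ M) Gᶜ ≤ _ := measure_mono hsub
      _ ≤ _ := measure_biUnion_finset_le _ _
      _ ≤ ∑ j ∈ Finset.range (2 ^ M), ENNReal.ofReal (2 / (2 ^ M) ^ 2) :=
        Finset.sum_le_sum fun j hj => gauss_colDot_sq_gt M j (Finset.mem_range.1 hj)
      _ = ENNReal.ofReal (2 / 2 ^ M) := by
        rw [Finset.sum_const, Finset.card_range, ← ENNReal.ofReal_nsmul]
        congr 1
        rw [nsmul_eq_mul]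
        push_cast
        field_simp
  have h1 : (1 : ℝ≥0∞) ≤ gauss (2 ^ M) G + gauss (2 ^ M) Gᶜ := by
    rw [← measure_univ (μ := gauss (2 ^ M)), ← Set.union_compl_self G]
    exact measure_union_le _ _
  rw [ENNReal.ofReal_sub _ (by positivity), ENNReal.ofReal_one, tsub_le_iff_right]
  exact h1.trans (add_le_add le_rfl hc)

/-! ## Trees and their posterior ratios -/

lemma mem_trees {L : ℕ} {S : Finset ℕ} : S ∈ trees L ↔ IsTree L S := by
  unfold trees
  rw [Finset.mem_filter, Finset.mem_powerset]
  exact ⟨fun h => h.2, fun h => ⟨fun j hj => Finset.mem_range.2 (h.2.2 j hj), h⟩⟩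

lemma mem_extSet {S : Finset ℕ} {j : ℕ} :
    j ∈ extSet S ↔ j ∉ S ∧ ∃ a ∈ S, j = 2 * a ∨ j = 2 * a + 1 := by
  unfold extSet
  simp only [Finset.mem_filter, Finset.mem_union, Finset.mem_image]
  constructor
  · rintro ⟨⟨a, ha, rfl⟩ | ⟨a, ha, rfl⟩, h⟩
    · exact ⟨h, a, ha, Or.inl rfl⟩
    · exact ⟨h, a, ha, Or.inr rfl⟩
  · rintro ⟨h, a, ha, rfl | rfl⟩
    · exact ⟨Or.inl ⟨a, ha, rfl⟩, h⟩
    · exact ⟨Or.inr ⟨a, ha, rfl⟩, h⟩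

lemma card_extSet {L : ℕ} {S : Finset ℕ} (hS : IsTree L S) : (extSet S).card = S.card := by
  set U := (S.image fun j => 2 * j) ∪ S.image fun j => 2 * j + 1 with hU
  have hext : extSet S = U \ S := by
    ext j
    simp [extSet, hU]
  have hsub : S ⊆ U := by
    intro j hj
    rcases Nat.eq_zero_or_pos j with rfl | hpos
    · exact Finset.mem_union_left _ (Finset.mem_image.2 ⟨0, hj, rfl⟩)
    · have hp := hS.2.1 j hj hpos
      rcases Nat.even_or_odd' j with ⟨k, rfl | rfl⟩
      · exact Finset.mem_union_left _ (Finset.mem_image.2 ⟨k, by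
          rwa [Nat.mul_div_cancel_left _ (by norm_num)] at hp, rfl⟩)
      · exact Finset.mem_union_right _ (Finset.mem_image.2 ⟨k, by
          rwa [show (2 * k + 1) / 2 = k by omega] at hp, rfl⟩)
  have hcard : U.card = 2 * S.card := by
    rw [hU, Finset.card_union_of_disjoint, Finset.card_image_of_injective,
      Finset.card_image_of_injective]
    · ring
    · intro a b h; simpa using h
    · intro a b h; simpa using h
    · rw [Finset.disjoint_left]
      intro x hx hx'
      obtain ⟨a, _, rfl⟩ := Finset.mem_image.1 hx
      obtain ⟨b, _, hb⟩ := Finset.mem_image.1 hx'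
      omega
  rw [hext, Finset.card_sdiff_of_subset hsub, hcard]
  omega

/-- Logarithm of the posterior factor contributed by an internal node `j`. -/
def nodeLog (n : ℕ) (c : ℝ) (Y : Fin n → ℝ) (j : ℕ) : ℝ :=
  Real.log (splitP n c) + Real.log (1 - splitP n c) - Real.log (1 + n) / 2
    + colDot n Y j ^ 2 / (2 * (n + 1))

lemma splitP_pos {n : ℕ} (hn : 0 < n) (c : ℝ) : 0 < splitP n c :=
  Real.rpow_pos_of_pos (by exact_mod_cast hn) _

lemma splitP_lt_one {n : ℕ} (hn : 1 < n) {c : ℝ} (hc : 0 < c) : splitP n c < 1 :=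
  Real.rpow_lt_one_of_one_lt_of_neg (by exact_mod_cast hn) (by linarith)

lemma postWt_eq {L n : ℕ} {c : ℝ} (hn : 1 < n) (hc : 0 < c) (Y : Fin n → ℝ) {S : Finset ℕ}
    (hS : IsTree L S) :
    postWt n (splitP n c) Y S = ((2 * π) ^ (-(n : ℝ) / 2) * Real.exp (-(1 / 2) * ∑ i, Y i ^ 2))
      * Real.exp (∑ j ∈ S, nodeLog n c Y j) := by
  have hp := splitP_pos (by omega : 0 < n) c
  have hp1 : 0 < 1 - splitP n c := sub_pos.2 (splitP_lt_one hn hc)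
  have hn1 : (0 : ℝ) < 1 + n := by positivity
  unfold postWt priorWt margLik nodeLog
  rw [card_extSet hS, Finset.sum_add_distrib, Finset.sum_const, nsmul_eq_mul, Real.exp_add,
    ← Finset.sum_div]
  have e1 : splitP n c ^ S.card = Real.exp (S.card * Real.log (splitP n c)) := by
    rw [Real.exp_nat_mul, Real.exp_log hp]
  have e2 : (1 - splitP n c) ^ S.card = Real.exp (S.card * Real.log (1 - splitP n c)) := by
    rw [Real.exp_nat_mul, Real.exp_log hp1]
  have e3 : (1 + n : ℝ) ^ (-(S.card : ℝ) / 2) = Real.exp (-(S.card * (Real.log (1 + n) / 2))) := by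
    rw [Real.rpow_def_of_pos hn1]; congr 1; ring
  have e4 : Real.exp (-(1 / 2) * ((∑ i, Y i ^ 2) - (1 / ((n : ℝ) + 1)) * ∑ j ∈ S, colDot n Y j ^ 2))
      = Real.exp (-(1 / 2) * ∑ i, Y i ^ 2)
        * Real.exp ((∑ j ∈ S, colDot n Y j ^ 2) / (2 * (n + 1))) := by
    rw [← Real.exp_add]; congr 1; field_simp; ring
  have e5 : Real.exp (S.card * (Real.log (splitP n c) + Real.log (1 - splitP n c)
      - Real.log (1 + n) / 2)) = Real.exp (S.card * Real.log (splitP n c))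
        * Real.exp (S.card * Real.log (1 - splitP n c))
        * Real.exp (-(S.card * (Real.log (1 + n) / 2))) := by
    rw [← Real.exp_add, ← Real.exp_add]; congr 1; ring
  rw [e1, e2, e3, e4, e5]
  ring

lemma post_eq {L n : ℕ} {c : ℝ} (hn : 1 < n) (hc : 0 < c) (Y : Fin n → ℝ) :
    ∃ K : ℝ, 0 < K ∧ ∀ S ∈ trees L, post L n (splitP n c) Y S
      = K * Real.exp (∑ j ∈ S, nodeLog n c Y j) := by
  set k := (2 * π) ^ (-(n : ℝ) / 2) * Real.exp (-(1 / 2) * ∑ i, Y i ^ 2) with hk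
  have hk0 : 0 < k := by positivity
  have hpos : ∀ T ∈ trees L, 0 < postWt n (splitP n c) Y T := by
    intro T hT
    rw [postWt_eq hn hc Y (mem_trees.1 hT)]
    positivity
  have hne : (trees L).Nonempty := by
    refine ⟨{0}, mem_trees.2 ⟨by simp, ?_, ?_⟩⟩
    · intro j hj h; rw [Finset.mem_singleton] at hj; omega
    · intro j hj; rw [Finset.mem_singleton] at hj; subst hj; positivity
  have hD : 0 < ∑ T ∈ trees L, postWt n (splitP n c) Y T := Finset.sum_pos hpos hne
  refine ⟨k / ∑ T ∈ trees L, postWt n (splitP n c) Y T, by positivity, fun S hS => ?_⟩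
  unfold post
  rw [postWt_eq hn hc Y (mem_trees.1 hS)]
  ring

lemma post_pos {L n : ℕ} {c : ℝ} (hn : 1 < n) (hc : 0 < c) (Y : Fin n → ℝ) {S : Finset ℕ}
    (hS : S ∈ trees L) : 0 < post L n (splitP n c) Y S := by
  obtain ⟨K, hK, h⟩ := post_eq (L := L) hn hc Y
  rw [h S hS]
  positivity

lemma postRatio_grow {L n : ℕ} {c : ℝ} (hn : 1 < n) (hc : 0 < c) (Y : Fin n → ℝ)
    {S T : Finset ℕ} (hS : S ∈ trees L) (hT : T ∈ trees L) (h : S ⊆ T) :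
    postRatio L n c Y S T = Real.exp (∑ j ∈ T \ S, nodeLog n c Y j) := by
  obtain ⟨K, hK, hp⟩ := post_eq (L := L) hn hc Y
  unfold postRatio
  rw [hp S hS, hp T hT, mul_div_mul_left _ _ hK.ne', ← Real.exp_sub, Finset.sum_sdiff_eq_sub h]

lemma postRatio_prune {L n : ℕ} {c : ℝ} (hn : 1 < n) (hc : 0 < c) (Y : Fin n → ℝ)
    {S T : Finset ℕ} (hS : S ∈ trees L) (hT : T ∈ trees L) (h : T ⊆ S) :
    postRatio L n c Y S T = Real.exp (-∑ j ∈ S \ T, nodeLog n c Y j) := by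
  rw [Real.exp_neg, ← postRatio_grow hn hc Y hT hS h, postRatio, postRatio, inv_div]

/-! ## Grow and prune neighborhoods -/

/-- Common properties of the neighborhoods of Bayesian CART and of its twiggy version;
`K` bounds the number of nodes added by one GROW move. -/
structure IsTwigNbhd (L K : ℕ) (Ng Np : Finset ℕ → Finset (Finset ℕ)) : Prop where
  grow_tree : ∀ S ∈ trees L, ∀ T ∈ Ng S, T ∈ trees L
  grow_ssubset : ∀ S ∈ trees L, ∀ T ∈ Ng S, S ⊂ T
  grow_card : ∀ S ∈ trees L, ∀ T ∈ Ng S, (T \ S).card ≤ K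
  grow_count : ∀ S ∈ trees L, (Ng S).card ≤ 2 ^ L
  prune_tree : ∀ S ∈ trees L, ∀ T ∈ Np S, T ∈ trees L
  prune_count : ∀ S ∈ trees L, (Np S).card ≤ 2 ^ L
  prune_rev : ∀ S ∈ trees L, ∀ T ∈ Np S, S ∈ Ng T
  prune_toward : ∀ S ∈ trees L, ∀ S₀ ∈ trees L, S₀ ⊂ S → ∃ T ∈ Np S, S₀ ⊆ T

lemma tree_subset_range {L : ℕ} {S : Finset ℕ} (hS : S ∈ trees L) : S ⊆ Finset.range (2 ^ L) :=
  fun j hj => Finset.mem_range.2 ((mem_trees.1 hS).2.2 j hj)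

lemma tree_card_le {L : ℕ} {S : Finset ℕ} (hS : S ∈ trees L) : S.card ≤ 2 ^ L := by
  simpa using Finset.card_le_card (tree_subset_range hS)

lemma isTwigNbhd_bcart (L : ℕ) : IsTwigNbhd L 1 (bNg L) bNp where
  grow_tree S hS T hT := by
    obtain ⟨j, hj, rfl⟩ := Finset.mem_image.1 hT
    obtain ⟨h0, hp, hlt⟩ := mem_trees.1 hS
    obtain ⟨hext, hjL⟩ := Finset.mem_filter.1 hj
    obtain ⟨hjS, a, ha, haj⟩ := mem_extSet.1 hext
    refine mem_trees.2 ⟨Finset.mem_insert_of_mem h0, fun i hi h1 => ?_, fun i hi => ?_⟩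
    · refine Finset.mem_insert_of_mem ?_
      rcases Finset.mem_insert.1 hi with rfl | hi
      · rwa [show i / 2 = a by omega]
      · exact hp i hi h1
    · rcases Finset.mem_insert.1 hi with rfl | hi
      · exact hjL
      · exact hlt i hi
  grow_ssubset S hS T hT := by
    obtain ⟨j, hj, rfl⟩ := Finset.mem_image.1 hT
    exact Finset.ssubset_insert (mem_extSet.1 (Finset.mem_filter.1 hj).1).1
  grow_card S hS T hT := by
    obtain ⟨j, hj, rfl⟩ := Finset.mem_image.1 hT
    calc (insert j S \ S).card ≤ ({j} : Finset ℕ).card := by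
          refine Finset.card_le_card fun i hi => ?_
          simp only [Finset.mem_sdiff, Finset.mem_insert] at hi
          simp only [Finset.mem_singleton]
          tauto
      _ = 1 := Finset.card_singleton j
  grow_count S hS := by
    refine Finset.card_image_le.trans ?_
    rw [← Finset.card_range (2 ^ L)]
    exact Finset.card_le_card fun j hj => Finset.mem_range.2 (Finset.mem_filter.1 hj).2
  prune_tree S hS T hT := by
    obtain ⟨j, hj, rfl⟩ := Finset.mem_image.1 hT
    obtain ⟨h0, hp, hlt⟩ := mem_trees.1 hS
    obtain ⟨hjS, hj0, hc0, hc1⟩ := Finset.mem_filter.1 hj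
    refine mem_trees.2 ⟨Finset.mem_erase.2 ⟨hj0.symm, h0⟩, fun i hi h1 => ?_, fun i hi =>
      hlt i (Finset.mem_of_mem_erase hi)⟩
    have hiS := Finset.mem_of_mem_erase hi
    refine Finset.mem_erase.2 ⟨fun h => ?_, hp i hiS h1⟩
    rcases (by omega : i = 2 * j ∨ i = 2 * j + 1) with rfl | rfl
    · exact hc0 hiS
    · exact hc1 hiS
  prune_count S hS := Finset.card_image_le.trans
    ((Finset.card_le_card (Finset.filter_subset _ _)).trans (tree_card_le hS))
  prune_rev S hS T hT := by
    obtain ⟨j, hj, rfl⟩ := Finset.mem_image.1 hT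
    obtain ⟨h0, hp, hlt⟩ := mem_trees.1 hS
    obtain ⟨hjS, hj0, hc0, hc1⟩ := Finset.mem_filter.1 hj
    refine Finset.mem_image.2 ⟨j, Finset.mem_filter.2 ⟨mem_extSet.2 ⟨by simp, j / 2, ?_, by omega⟩,
      hlt j hjS⟩, Finset.insert_erase hjS⟩
    exact Finset.mem_erase.2 ⟨by omega, hp j hjS (by omega)⟩
  prune_toward S hS S₀ hS₀ h := by
    obtain ⟨h0, hp, hlt⟩ := mem_trees.1 hS₀
    have hne : (S \ S₀).Nonempty := Finset.sdiff_nonempty.2 h.2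
    have hm := Finset.max'_mem (S \ S₀) hne
    have hmax : ∀ i ∈ S, i ∉ S₀ → i ≤ (S \ S₀).max' hne := fun i hi hi' =>
      Finset.le_max' _ _ (Finset.mem_sdiff.2 ⟨hi, hi'⟩)
    set m := (S \ S₀).max' hne
    obtain ⟨hmS, hmS₀⟩ := Finset.mem_sdiff.1 hm
    have hm0 : m ≠ 0 := fun h => hmS₀ (h ▸ h0)
    refine ⟨S.erase m, Finset.mem_image.2 ⟨m, Finset.mem_filter.2 ⟨hmS, hm0, fun hc => ?_,
      fun hc => ?_⟩, rfl⟩, Finset.subset_erase.2 ⟨h.1, hmS₀⟩⟩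
    · have := hmax _ hc fun hcS => hmS₀ (by
        have := hp _ hcS (by omega); rwa [show 2 * m / 2 = m by omega] at this)
      omega
    · have := hmax _ hc fun hcS => hmS₀ (by
        have := hp _ hcS (by omega); rwa [show (2 * m + 1) / 2 = m by omega] at this)
      omega

lemma isAnc_iff {a b : ℕ} (ha : a ≠ 0) : isAnc a b ↔ ∃ t, 1 ≤ t ∧ b / 2 ^ t = a := by
  unfold isAnc
  constructor
  · rintro ⟨t, ht, h⟩
    exact ⟨t, (Finset.mem_Icc.1 ht).1, h⟩
  · rintro ⟨t, ht, h⟩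
    refine ⟨t, Finset.mem_Icc.2 ⟨ht, ?_⟩, h⟩
    by_contra hcon
    have : b < 2 ^ t := (Nat.lt_two_pow_self).trans
      (Nat.pow_lt_pow_right (by norm_num) (not_le.1 hcon))
    exact ha (h ▸ Nat.div_eq_of_lt this)

lemma isAnc_lt {a b : ℕ} (h : isAnc a b) : a < b := by
  obtain ⟨t, ht, rfl⟩ := h
  rw [Finset.mem_Icc] at ht
  exact Nat.div_lt_self (by omega) (Nat.one_lt_two_pow (by omega))

lemma isAnc_trans {a b d : ℕ} (ha : a ≠ 0) (h : isAnc a b) (h' : isAnc b d) : isAnc a d := by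
  have hb : b ≠ 0 := by have := isAnc_lt h; omega
  obtain ⟨t, ht, e⟩ := (isAnc_iff ha).1 h
  obtain ⟨t', ht', rfl⟩ := (isAnc_iff hb).1 h'
  exact (isAnc_iff ha).2 ⟨t' + t, by omega, by rw [pow_add, ← Nat.div_div_eq_div_mul, e]⟩

lemma mem_ancPath_div (j t : ℕ) : j / 2 ^ t ∈ insert 0 (ancPath j) := by
  by_cases h : t ≤ j
  · exact Finset.mem_insert_of_mem
      (Finset.mem_image.2 ⟨t, Finset.mem_range.2 (by omega), rfl⟩)
  · rw [Nat.div_eq_of_lt ((Nat.lt_two_pow_self).trans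
      (Nat.pow_lt_pow_right (by norm_num) (not_le.1 h)))]
    exact Finset.mem_insert_self _ _

lemma self_mem_ancPath (j : ℕ) : j ∈ ancPath j :=
  Finset.mem_image.2 ⟨0, Finset.mem_range.2 (by omega), by simp⟩

lemma mem_ancPath_iff {a j : ℕ} (ha : a ≠ 0) : a ∈ ancPath j ↔ a = j ∨ isAnc a j := by
  constructor
  · intro h
    obtain ⟨t, -, rfl⟩ := Finset.mem_image.1 h
    rcases Nat.eq_zero_or_pos t with rfl | ht
    · left; simp
    · exact Or.inr ((isAnc_iff ha).2 ⟨t, ht, rfl⟩)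
  · rintro (rfl | h)
    · exact self_mem_ancPath _
    · obtain ⟨t, -, rfl⟩ := (isAnc_iff ha).1 h
      exact (Finset.mem_insert.1 (mem_ancPath_div j t)).resolve_left ha

lemma isTree_anc_mem {L : ℕ} {S : Finset ℕ} (hS : IsTree L S) {j : ℕ} (hj : j ∈ S) (t : ℕ) :
    j / 2 ^ t ∈ S := by
  induction t with
  | zero => simpa using hj
  | succ t ih =>
    rw [pow_succ, ← Nat.div_div_eq_div_mul]
    rcases Nat.eq_zero_or_pos (j / 2 ^ t) with h | h
    · rw [h]; exact hS.1
    · exact hS.2.1 _ ih h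

lemma ancPath_subset {L : ℕ} {S : Finset ℕ} (hS : IsTree L S) {j : ℕ} (hj : j ∈ S) :
    ancPath j ⊆ S := by
  intro a ha
  obtain ⟨t, -, rfl⟩ := Finset.mem_image.1 ha
  exact isTree_anc_mem hS hj t

lemma card_ancPath_erase_zero {L j : ℕ} (hj : j < 2 ^ L) : ((ancPath j).erase 0).card ≤ L := by
  have key : ∀ a ∈ (ancPath j).erase 0, a = j / 2 ^ (Nat.log 2 j - Nat.log 2 a) ∧ a ≤ j := by
    intro a ha
    obtain ⟨ha0, ha⟩ := Finset.mem_erase.1 ha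
    obtain ⟨t, -, rfl⟩ := Finset.mem_image.1 ha
    have hle : j / 2 ^ t ≤ j := Nat.div_le_self _ _
    have hlog : Nat.log 2 (j / 2 ^ t) = Nat.log 2 j - t := Nat.log_div_base_pow _ _ _
    have htl : t ≤ Nat.log 2 j := by
      have : 2 ^ t ≤ j := by
        by_contra hcon
        exact ha0 (Nat.div_eq_of_lt (not_le.1 hcon))
      exact Nat.le_log_of_pow_le (by norm_num) this
    exact ⟨by rw [hlog, Nat.sub_sub_self htl], hle⟩
  calc ((ancPath j).erase 0).card = (((ancPath j).erase 0).image (Nat.log 2)).card := by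
        refine (Finset.card_image_of_injOn fun a ha b hb hab => ?_).symm
        rw [(key a ha).1, (key b hb).1, hab]
    _ ≤ (Finset.range L).card := by
        refine Finset.card_le_card fun x hx => ?_
        obtain ⟨a, ha, rfl⟩ := Finset.mem_image.1 hx
        exact Finset.mem_range.2 (Nat.log_lt_of_lt_pow (Finset.mem_erase.1 ha).1
          ((key a ha).2.trans_lt hj))
    _ = L := Finset.card_range L

lemma isTree_growTwig {L : ℕ} {S : Finset ℕ} (hS : IsTree L S) {j : ℕ} (hj : j < 2 ^ L) :
    IsTree L (growTwig S j) := by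
  obtain ⟨h0, hp, hlt⟩ := hS
  refine ⟨Finset.mem_union_left _ h0, fun i hi h1 => ?_, fun i hi => ?_⟩
  · rcases Finset.mem_union.1 hi with hi | hi
    · exact Finset.mem_union_left _ (hp i hi h1)
    · obtain ⟨t, -, rfl⟩ := Finset.mem_image.1 hi
      rw [Nat.div_div_eq_div_mul, ← pow_succ]
      rcases Finset.mem_insert.1 (mem_ancPath_div j (t + 1)) with h | h
      · rw [h]; exact Finset.mem_union_left _ h0
      · exact Finset.mem_union_right _ h
  · rcases Finset.mem_union.1 hi with hi | hi
    · exact hlt i hi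
    · obtain ⟨t, -, rfl⟩ := Finset.mem_image.1 hi
      exact (Nat.div_le_self _ _).trans_lt hj

lemma isTree_pruneTwig {L : ℕ} {S : Finset ℕ} (hS : IsTree L S) {j : ℕ} (hj : j ≠ 0) :
    IsTree L (pruneTwig S j) := by
  obtain ⟨h0, hp, hlt⟩ := hS
  have hmem : ∀ i, i ∈ pruneTwig S j ↔ i ∈ S ∧ i ≠ j ∧ ¬ isAnc j i := by
    intro i
    simp only [pruneTwig, descIn, Finset.mem_sdiff, Finset.mem_insert, Finset.mem_filter]
    tauto
  refine ⟨(hmem 0).2 ⟨h0, hj.symm, fun h => ?_⟩, fun i hi h1 => ?_, fun i hi => ?_⟩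
  · have := isAnc_lt h; omega
  · obtain ⟨hiS, hij, hia⟩ := (hmem i).1 hi
    have hanc : i / 2 = j → isAnc j i := fun h => (isAnc_iff hj).2 ⟨1, le_rfl, by simpa using h⟩
    refine (hmem _).2 ⟨hp i hiS h1, fun h => hia (hanc h), fun h => hia ?_⟩
    have hi2 : i / 2 ≠ 0 := by have := isAnc_lt h; omega
    exact isAnc_trans hj h ((isAnc_iff hi2).2 ⟨1, le_rfl, by simp⟩)
  · exact hlt i ((hmem i).1 hi).1

lemma isTwigNbhd_twiggy (L : ℕ) : IsTwigNbhd L L (tNg L) tNp where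
  grow_tree S hS T hT := by
    obtain ⟨j, hj, rfl⟩ := Finset.mem_image.1 hT
    exact mem_trees.2 (isTree_growTwig (mem_trees.1 hS)
      (Finset.mem_range.1 (Finset.mem_filter.1 hj).1))
  grow_ssubset S hS T hT := by
    obtain ⟨j, hj, rfl⟩ := Finset.mem_image.1 hT
    refine (Finset.ssubset_iff_of_subset Finset.subset_union_left).2 ⟨j, ?_,
      (Finset.mem_filter.1 hj).2⟩
    exact Finset.mem_union_right _ (self_mem_ancPath j)
  grow_card S hS T hT := by
    obtain ⟨j, hj, rfl⟩ := Finset.mem_image.1 hT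
    refine (Finset.card_le_card fun i hi => ?_).trans
      (card_ancPath_erase_zero (Finset.mem_range.1 (Finset.mem_filter.1 hj).1))
    simp only [growTwig, Finset.mem_sdiff, Finset.mem_union] at hi
    refine Finset.mem_erase.2 ⟨fun h => hi.2 (h ▸ (mem_trees.1 hS).1), by tauto⟩
  grow_count S hS := by
    refine Finset.card_image_le.trans ((Finset.card_le_card (Finset.filter_subset _ _)).trans ?_)
    rw [Finset.card_range]
  prune_tree S hS T hT := by
    obtain ⟨j, hj, rfl⟩ := Finset.mem_image.1 hT
    exact mem_trees.2 (isTree_pruneTwig (mem_trees.1 hS) (Finset.mem_filter.1 hj).2.1)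
  prune_count S hS := Finset.card_image_le.trans
    ((Finset.card_le_card (Finset.filter_subset _ _)).trans (tree_card_le hS))
  prune_rev S hS T hT := by
    obtain ⟨j, hj, rfl⟩ := Finset.mem_image.1 hT
    obtain ⟨hjS, hj0, hchain⟩ := Finset.mem_filter.1 hj
    have hT' := mem_trees.1 hS
    set R := insert j (descIn S j) with hR
    have hRS : R ⊆ S := Finset.insert_subset hjS (Finset.filter_subset _ _)
    have hne : R.Nonempty := ⟨j, Finset.mem_insert_self _ _⟩
    have hm := Finset.max'_mem R hne
    have hmax : ∀ i ∈ R, i ≤ R.max' hne := fun i hi => Finset.le_max' _ _ hi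
    set m := R.max' hne
    have hjR : ∀ i ∈ R, i ≠ 0 := by
      intro i hi
      rcases Finset.mem_insert.1 hi with rfl | hi
      · exact hj0
      · have := isAnc_lt (Finset.mem_filter.1 hi).2; omega
    have hchainR : ∀ i ∈ R, i = m ∨ isAnc i m := by
      intro i hi
      have hnot : ∀ b ∈ R, ¬ isAnc m b := fun b hb h =>
        absurd (isAnc_lt h) (not_lt.2 (hmax b hb))
      rcases Finset.mem_insert.1 hi with rfl | hi'
      · rcases Finset.mem_insert.1 hm with h | h
        · exact Or.inl h.symm
        · exact Or.inr (Finset.mem_filter.1 h).2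
      · rcases Finset.mem_insert.1 hm with h | h
        · exact absurd (h ▸ (Finset.mem_filter.1 hi').2) (hnot i hi)
        · rcases hchain i hi' m h with e | e | e
          · exact Or.inl e
          · exact Or.inr e
          · exact absurd e (hnot i hi)
    refine Finset.mem_image.2 ⟨m, Finset.mem_filter.2 ⟨tree_subset_range hS (hRS hm), ?_⟩, ?_⟩
    · exact fun h => (Finset.mem_sdiff.1 h).2 hm
    · refine Finset.Subset.antisymm (Finset.union_subset Finset.sdiff_subset
        (ancPath_subset hT' (hRS hm))) fun i hi => ?_
      by_cases hiR : i ∈ R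
      · exact Finset.mem_union_right _ ((mem_ancPath_iff (hjR i hiR)).2 (hchainR i hiR))
      · exact Finset.mem_union_left _ (Finset.mem_sdiff.2 ⟨hi, hiR⟩)
  prune_toward S hS S₀ hS₀ h := by
    have hT₀ := mem_trees.1 hS₀
    have hne : (S \ S₀).Nonempty := Finset.sdiff_nonempty.2 h.2
    have hm := Finset.max'_mem (S \ S₀) hne
    have hmax : ∀ i ∈ S, i ∉ S₀ → i ≤ (S \ S₀).max' hne := fun i hi hi' =>
      Finset.le_max' _ _ (Finset.mem_sdiff.2 ⟨hi, hi'⟩)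
    set m := (S \ S₀).max' hne
    obtain ⟨hmS, hmS₀⟩ := Finset.mem_sdiff.1 hm
    have hm0 : m ≠ 0 := fun h => hmS₀ (h ▸ hT₀.1)
    have hanc : ∀ i ∈ S₀, ¬ isAnc m i := by
      intro i hi ha
      obtain ⟨t, -, e⟩ := (isAnc_iff hm0).1 ha
      exact hmS₀ (e ▸ isTree_anc_mem hT₀ hi t)
    have hdesc : ∀ i ∈ S, ¬ isAnc m i := by
      intro i hi ha
      by_cases hi0 : i ∈ S₀
      · exact hanc i hi0 ha
      · exact absurd (isAnc_lt ha) (not_lt.2 (hmax i hi hi0))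
    refine ⟨pruneTwig S m, Finset.mem_image.2 ⟨m, Finset.mem_filter.2 ⟨hmS, hm0,
      fun a ha => absurd (Finset.mem_filter.1 ha).2 (hdesc a (Finset.mem_filter.1 ha).1)⟩, rfl⟩,
      fun i hi => Finset.mem_sdiff.2 ⟨h.1 hi, fun hc => ?_⟩⟩
    rcases Finset.mem_insert.1 hc with rfl | hc
    · exact hmS₀ hi
    · exact hanc i hi (Finset.mem_filter.1 hc).2

/-! ## Informed proposals and Metropolis–Hastings acceptance -/

lemma mhTrans_nonneg {L : ℕ} {π₀ : Finset ℕ → ℝ} {q : Finset ℕ → Finset ℕ → ℝ} {S T : Finset ℕ}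
    (h : T ≠ S) (hS : 0 ≤ π₀ S) (hT : 0 ≤ π₀ T) (h1 : 0 ≤ q S T) (h2 : 0 ≤ q T S) :
    0 ≤ mhTrans L π₀ q S T := by
  rw [mhTrans, if_neg h]
  positivity

lemma mhTrans_le_reverse {L : ℕ} {π₀ : Finset ℕ → ℝ} {q : Finset ℕ → Finset ℕ → ℝ}
    {S T : Finset ℕ} (h : T ≠ S) (hS : 0 ≤ π₀ S) (hT : 0 ≤ π₀ T) (h1 : 0 ≤ q S T)
    (h2 : 0 ≤ q T S) : mhTrans L π₀ q S T ≤ π₀ T / π₀ S * q T S := by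
  rw [mhTrans, if_neg h]
  rcases h1.eq_or_lt with h0 | h0
  · rw [← h0, zero_mul]
    positivity
  · calc q S T * min 1 (π₀ T * q T S / (π₀ S * q S T))
        ≤ q S T * (π₀ T * q T S / (π₀ S * q S T)) := by gcongr; exact min_le_right _ _
      _ = π₀ T / π₀ S * q T S := by
        rw [div_mul_eq_mul_div, mul_comm (π₀ S), ← div_div, ← mul_div_assoc, mul_div_assoc']
        rw [mul_div_cancel_left₀ _ h0.ne']

lemma mhTrans_eq_of_le {L : ℕ} {π₀ : Finset ℕ → ℝ} {q : Finset ℕ → Finset ℕ → ℝ}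
    {S T : Finset ℕ} (h : T ≠ S) (hpos : 0 < π₀ S * q S T)
    (hle : π₀ S * q S T ≤ π₀ T * q T S) : mhTrans L π₀ q S T = q S T := by
  rw [mhTrans, if_neg h, min_eq_left ((one_le_div hpos).2 hle), mul_one]

section Informed

variable {L K n : ℕ} {c A : ℝ} {Y : Fin n → ℝ} {Ng Np : Finset ℕ → Finset (Finset ℕ)}

lemma IsTwigNbhd.prune_ssubset (nb : IsTwigNbhd L K Ng Np) {S T : Finset ℕ} (hS : S ∈ trees L)
    (hT : T ∈ Np S) : T ⊂ S :=
  nb.grow_ssubset T (nb.prune_tree S hS T hT) S (nb.prune_rev S hS T hT)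

lemma postRatio_pos (hn : 1 < n) (hc : 0 < c) {S T : Finset ℕ} (hS : S ∈ trees L)
    (hT : T ∈ trees L) : 0 < postRatio L n c Y S T :=
  div_pos (post_pos hn hc Y hT) (post_pos hn hc Y hS)

lemma wg_pos (hn : 1 < n) (hc : 0 < c) {S T : Finset ℕ} (hS : S ∈ trees L)
    (hT : T ∈ trees L) : 0 < wg L n c A Y S T :=
  lt_min (postRatio_pos hn hc hS hT) (Real.rpow_pos_of_pos (by exact_mod_cast hn.le) _)

lemma one_le_wp {S T : Finset ℕ} : 1 ≤ wp L n c Y S T := le_max_left _ _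

lemma wp_pos {S T : Finset ℕ} : 0 < wp L n c Y S T := zero_lt_one.trans_le one_le_wp

lemma infProp_of_prune (nb : IsTwigNbhd L K Ng Np) {S T : Finset ℕ} (hS : S ∈ trees L)
    (hT : T ∈ Np S) :
    infProp L n c A Y Ng Np S T = 1 / 2 * (wp L n c Y S T / Zp L n c Y Np S) := by
  have : T ∉ Ng S := fun h => (nb.prune_ssubset hS hT).2 (nb.grow_ssubset S hS T h).1
  rw [infProp, if_neg this, if_pos hT]
  ring

lemma infProp_reverse_of_prune (nb : IsTwigNbhd L K Ng Np) {S T : Finset ℕ} (hS : S ∈ trees L)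
    (hT : T ∈ Np S) :
    infProp L n c A Y Ng Np T S = 1 / 2 * (wg L n c A Y T S / Zg L n c A Y Ng T) := by
  have hTt := nb.prune_tree S hS T hT
  have : S ∉ Np T := fun h => (nb.prune_ssubset hS hT).2 (nb.prune_ssubset hTt h).1
  rw [infProp, if_neg this, if_pos (nb.prune_rev S hS T hT)]
  ring

lemma wg_div_Zg_le_one (nb : IsTwigNbhd L K Ng Np) (hn : 1 < n) (hc : 0 < c) {S T : Finset ℕ}
    (hS : S ∈ trees L) (hT : T ∈ Ng S) : wg L n c A Y S T / Zg L n c A Y Ng S ≤ 1 := by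
  have hpos : ∀ U ∈ Ng S, 0 < wg L n c A Y S U := fun U hU =>
    wg_pos hn hc hS (nb.grow_tree S hS U hU)
  exact div_le_one_of_le₀ (Finset.single_le_sum (fun U hU => (hpos U hU).le) hT)
    (Finset.sum_nonneg fun U hU => (hpos U hU).le)

lemma wp_div_Zp_le_one {S T : Finset ℕ} (hT : T ∈ Np S) :
    wp L n c Y S T / Zp L n c Y Np S ≤ 1 :=
  div_le_one_of_le₀ (Finset.single_le_sum (f := fun U => wp L n c Y S U) (fun _ _ => wp_pos.le) hT)
    (Finset.sum_nonneg fun _ _ => wp_pos.le)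

lemma infProp_nonneg (nb : IsTwigNbhd L K Ng Np) (hn : 1 < n) (hc : 0 < c) {S T : Finset ℕ}
    (hS : S ∈ trees L) : 0 ≤ infProp L n c A Y Ng Np S T := by
  have hZg : 0 ≤ Zg L n c A Y Ng S := Finset.sum_nonneg fun U hU =>
    (wg_pos hn hc hS (nb.grow_tree S hS U hU)).le
  have hZp : 0 ≤ Zp L n c Y Np S := Finset.sum_nonneg fun _ _ => wp_pos.le
  have hw : 0 ≤ wp L n c Y S T := wp_pos.le
  rw [infProp]
  split_ifs with h1
  · have := (wg_pos (A := A) (Y := Y) hn hc hS (nb.grow_tree S hS T h1)).le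
    positivity
  · have := (wg_pos (A := A) (Y := Y) hn hc hS (nb.grow_tree S hS T h1)).le
    positivity
  · positivity
  · norm_num

lemma infProp_reverse_of_grow_le (nb : IsTwigNbhd L K Ng Np) {S T : Finset ℕ} (hS : S ∈ trees L)
    (hT : T ∈ Ng S) : infProp L n c A Y Ng Np T S ≤ 1 / 2 := by
  have : S ∉ Ng T := fun h => (nb.grow_ssubset S hS T hT).2
    (nb.grow_ssubset T (nb.grow_tree S hS T hT) S h).1
  rw [infProp, if_neg this]
  split_ifs with h
  · have := wp_div_Zp_le_one (L := L) (n := n) (c := c) (Y := Y) h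
    linarith
  · norm_num

lemma infProp_reverse_of_prune_le (nb : IsTwigNbhd L K Ng Np) (hn : 1 < n) (hc : 0 < c)
    {S T : Finset ℕ} (hS : S ∈ trees L) (hT : T ∈ Np S) :
    infProp L n c A Y Ng Np T S ≤ 1 / 2 := by
  rw [infProp_reverse_of_prune nb hS hT]
  have := wg_div_Zg_le_one (A := A) (Y := Y) nb hn hc (nb.prune_tree S hS T hT)
    (nb.prune_rev S hS T hT)
  linarith

/-! ## The drift function near overfitted trees -/

lemma V2_of_superset {Sstar S : Finset ℕ} (h : Sstar ⊆ S) :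
    V2 L Sstar S = Real.exp (1 / 2 ^ L * ((S.card : ℝ) - Sstar.card)) := by
  rw [V2, Finset.sdiff_eq_empty_iff_subset.2 h, Finset.cast_card_sdiff h]
  simp

lemma driftR_grow_le {Sstar S T : Finset ℕ} (h : Sstar ⊆ S) (hST : S ⊂ T)
    (hK : (T \ S).card ≤ K) (hKL : K ≤ 2 ^ L) :
    driftR (V2 L Sstar) S T ≤ 2 * (K / 2 ^ L) := by
  have hL : (0 : ℝ) < 2 ^ L := by positivity
  have hcard := Finset.cast_card_sdiff (R := ℝ) hST.1
  have hK' : ((T \ S).card : ℝ) ≤ K := by exact_mod_cast hK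
  have hKL' : (K : ℝ) / 2 ^ L ≤ 1 := by
    rw [div_le_one hL]; exact_mod_cast hKL
  rw [driftR, V2_of_superset h, V2_of_superset (h.trans hST.1), ← Real.exp_sub]
  have hx0 : (0 : ℝ) ≤ K / 2 ^ L := by positivity
  have hx : 1 / 2 ^ L * ((T.card : ℝ) - Sstar.card) - 1 / 2 ^ L * ((S.card : ℝ) - Sstar.card)
      ≤ K / 2 ^ L := by
    rw [← mul_sub, one_div_mul_eq_div]
    gcongr
    linarith
  have h1 := Real.exp_le_exp.2 hx
  have h2 := Real.abs_exp_sub_one_le (x := K / 2 ^ L) (by rw [abs_of_nonneg hx0]; exact hKL')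
  rw [abs_of_nonneg hx0] at h2
  linarith [le_abs_self (Real.exp ((K : ℝ) / 2 ^ L) - 1)]

lemma driftR_prune_le_of_superset {Sstar S T : Finset ℕ} (h : Sstar ⊆ T) (hTS : T ⊂ S) :
    driftR (V2 L Sstar) S T ≤ -(1 / 2 ^ (L + 1)) := by
  have hL : (1 : ℝ) ≤ 2 ^ L := one_le_pow₀ (by norm_num)
  have hcard : (T.card : ℝ) + 1 ≤ S.card := by exact_mod_cast Finset.card_lt_card hTS
  rw [driftR, V2_of_superset h, V2_of_superset (h.trans hTS.1), ← Real.exp_sub]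
  set x : ℝ := 1 / 2 ^ L with hx
  have hx0 : 0 < x := by positivity
  have hx1 : x ≤ 1 := by rw [hx, div_le_one (by positivity)]; exact hL
  have hle : x * ((T.card : ℝ) - Sstar.card) - x * ((S.card : ℝ) - Sstar.card) ≤ -x := by
    nlinarith
  have h1 := Real.exp_le_exp.2 hle
  have h2 : Real.exp (-x) ≤ 1 - x / 2 := by
    rw [Real.exp_neg, inv_le_iff_one_le_mul₀ (Real.exp_pos x)]
    nlinarith [Real.add_one_le_exp x]
  have h3 : (1 : ℝ) / 2 ^ (L + 1) = x / 2 := by rw [hx, pow_succ]; field_simp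
  rw [h3]
  linarith

lemma driftR_prune_le_two {Sstar S T : Finset ℕ} (hS : S ∈ trees L) (h : Sstar ⊆ S)
    (hTS : T ⊂ S) : driftR (V2 L Sstar) S T ≤ 2 := by
  have hL : (0 : ℝ) < 2 ^ L := by positivity
  rw [driftR, V2_of_superset h, V2, ← Real.exp_sub, ← Finset.cast_card_sdiff h]
  have hx : 1 / 2 ^ L * (((T \ Sstar).card : ℝ) + min ((Sstar \ T).card : ℝ) 1
      * (2 ^ L - ((T ∪ Sstar).card : ℝ))) - 1 / 2 ^ L * ((S \ Sstar).card : ℝ) ≤ 1 := by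
    rw [← mul_sub, one_div_mul_eq_div, div_le_one hL]
    have h1 : ((T \ Sstar).card : ℝ) ≤ (S \ Sstar).card := by
      exact_mod_cast Finset.card_le_card (Finset.sdiff_subset_sdiff hTS.1 le_rfl)
    have h2 : ((T ∪ Sstar).card : ℝ) ≤ 2 ^ L := by
      exact_mod_cast (Finset.card_le_card (Finset.union_subset hTS.1 h)).trans (tree_card_le hS)
    have h3 : (0 : ℝ) ≤ (T ∪ Sstar).card := by positivity
    have h4 : min ((Sstar \ T).card : ℝ) 1 ≤ 1 := min_le_right _ _
    nlinarith
  have h1 := Real.exp_le_exp.2 hx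
  linarith [Real.exp_one_lt_d9]

/-! ## Drift ratio sums from posterior ratio bounds -/

/-- Posterior ratio bounds around trees containing `Sstar`. -/
structure RatioBounds (L K n : ℕ) (c A : ℝ) (Y : Fin n → ℝ) (Sstar : Finset ℕ) : Prop where
  grow_le : ∀ S ∈ trees L, ∀ T ∈ trees L, Sstar ⊆ S → S ⊂ T →
    postRatio L n c Y S T ≤ (n : ℝ) ^ (3 / 2 - c)
  drop_le : ∀ S ∈ trees L, ∀ T ∈ trees L, Sstar ⊆ S → T ⊂ S → ¬ Sstar ⊆ T →
    (S \ T).card ≤ K → postRatio L n c Y S T ≤ (n : ℝ) ^ (-(A ^ 2 * Real.log n / 8))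

lemma grow_drift_sum_le (nb : IsTwigNbhd L K Ng Np) {Sstar : Finset ℕ}
    (rb : RatioBounds L K n c A Y Sstar) (hn : 1 < n) (hc : 0 < c) (hKL : K ≤ 2 ^ L)
    {S : Finset ℕ} (hS : S ∈ trees L) (hsub : Sstar ⊆ S) :
    ∑ T ∈ Ng S, driftR (V2 L Sstar) S T
      * mhTrans L (post L n (splitP n c) Y) (infProp L n c A Y Ng Np) S T
      ≤ K / (n : ℝ) ^ (c - 3 / 2) := by
  have hn0 : (0 : ℝ) < n := by exact_mod_cast (by omega : 0 < n)
  have hL : (0 : ℝ) < 2 ^ L := by positivity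
  set u := (n : ℝ) ^ (3 / 2 - c) with hu
  have hu0 : 0 < u := Real.rpow_pos_of_pos hn0 _
  have hterm : ∀ T ∈ Ng S, driftR (V2 L Sstar) S T
      * mhTrans L (post L n (splitP n c) Y) (infProp L n c A Y Ng Np) S T ≤ K / 2 ^ L * u := by
    intro T hT
    have hTt := nb.grow_tree S hS T hT
    have hss := nb.grow_ssubset S hS T hT
    have hq1 := infProp_nonneg (A := A) (Y := Y) (T := T) nb hn hc hS
    have hq2 := infProp_nonneg (A := A) (Y := Y) (T := S) nb hn hc hTt
    have hP0 := mhTrans_nonneg (L := L) hss.ne' (post_pos hn hc Y hS).le (post_pos hn hc Y hTt).le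
      hq1 hq2
    have hP := mhTrans_le_reverse (L := L) hss.ne' (post_pos hn hc Y hS).le
      (post_pos hn hc Y hTt).le hq1 hq2
    have hr : post L n (splitP n c) Y T / post L n (splitP n c) Y S ≤ u :=
      rb.grow_le S hS T hTt hsub hss
    have hq3 := infProp_reverse_of_grow_le (n := n) (c := c) (A := A) (Y := Y) nb hS hT
    have hP' := hP.trans (mul_le_mul hr hq3 hq2 hu0.le)
    have hR := driftR_grow_le hsub hss (nb.grow_card S hS T hT) hKL
    calc _ ≤ 2 * (K / 2 ^ L) * (u * (1 / 2)) := mul_le_mul hR hP' hP0 (by positivity)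
      _ = K / 2 ^ L * u := by ring
  calc _ ≤ (Ng S).card • (K / 2 ^ L * u) := Finset.sum_le_card_nsmul _ _ _ hterm
    _ = ((Ng S).card : ℝ) * (K / 2 ^ L * u) := nsmul_eq_mul _ _
    _ ≤ 2 ^ L * (K / 2 ^ L * u) := by
      gcongr
      exact_mod_cast nb.grow_count S hS
    _ = K / (n : ℝ) ^ (c - 3 / 2) := by
      rw [hu, show 3 / 2 - c = -(c - 3 / 2) by ring, Real.rpow_neg hn0.le]
      field_simp

lemma prune_drift_sum_le (nb : IsTwigNbhd L K Ng Np) {Sstar : Finset ℕ}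
    (hstar : Sstar ∈ trees L) (rb : RatioBounds L K n c A Y Sstar) (hn : 1 < n)
    (hc : 5 / 2 < c) (hLn : 2 ^ L ≤ n) {S : Finset ℕ} (hS : S ∈ trees L) (hsub : Sstar ⊂ S) :
    ∑ T ∈ Np S, driftR (V2 L Sstar) S T
      * mhTrans L (post L n (splitP n c) Y) (infProp L n c A Y Ng Np) S T
      ≤ -(1 / 2 ^ (L + 2) / (1 + (n : ℝ) ^ (5 / 2 - c)))
        + (n : ℝ) ^ (1 - A ^ 2 * Real.log n / 8) := by
  have hc0 : 0 < c := by linarith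
  have hn1 : (1 : ℝ) < n := by exact_mod_cast hn
  have hn0 : (0 : ℝ) < n := by linarith
  have hlog : 0 ≤ Real.log n := Real.log_nonneg hn1.le
  set W := (n : ℝ) ^ (c - 3 / 2) with hW
  have hnW : (n : ℝ) ≤ W := by
    calc (n : ℝ) = (n : ℝ) ^ (1 : ℝ) := (Real.rpow_one _).symm
      _ ≤ W := Real.rpow_le_rpow_of_exponent_le hn1.le (by linarith)
  have hW0 : 0 < W := by linarith
  have hWinv : (n : ℝ) ^ (3 / 2 - c) = W⁻¹ := by
    rw [hW, ← Real.rpow_neg hn0.le]; congr 1; ring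
  have hx : (n : ℝ) ^ (5 / 2 - c) = n / W := by
    rw [show 5 / 2 - c = 1 - (c - 3 / 2) by ring, Real.rpow_sub hn0, Real.rpow_one]
  set δ := (n : ℝ) ^ (-(A ^ 2 * Real.log n / 8)) with hδ
  have hδ0 : 0 < δ := Real.rpow_pos_of_pos hn0 _
  have hδ1 : δ ≤ 1 := Real.rpow_le_one_of_one_le_of_nonpos hn1.le (by
    have : 0 ≤ A ^ 2 * Real.log n / 8 := by positivity
    linarith)
  have hcap : 1 ≤ (n : ℝ) ^ ((A ^ 2 * Real.log n) / 8) :=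
    Real.one_le_rpow hn1.le (by positivity)
  set P := mhTrans L (post L n (splitP n c) Y) (infProp L n c A Y Ng Np) with hP
  set Z := Zp L n c Y Np S with hZ
  set F := (Np S).filter fun T => Sstar ⊆ T with hF
  set G := (Np S).filter fun T => ¬ Sstar ⊆ T with hG
  have hwF : ∀ T ∈ F, wp L n c Y S T = W := by
    intro T hT
    obtain ⟨hT, hTs⟩ := Finset.mem_filter.1 hT
    have hTt := nb.prune_tree S hS T hT
    have h1 := rb.grow_le T hTt S hS hTs (nb.prune_ssubset hS hT)
    have h2 : W ≤ postRatio L n c Y S T := by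
      have : postRatio L n c Y S T = (postRatio L n c Y T S)⁻¹ := by
        rw [postRatio, postRatio, inv_div]
      rw [this, le_inv_comm₀ hW0 (postRatio_pos hn hc0 hTt hS), ← hWinv]
      exact h1
    rw [wp, min_eq_right h2, max_eq_right (by linarith)]
  have hwG : ∀ T ∈ G, wp L n c Y S T = 1 := by
    intro T hT
    obtain ⟨hT, hTs⟩ := Finset.mem_filter.1 hT
    have hTt := nb.prune_tree S hS T hT
    have h1 := rb.drop_le S hS T hTt hsub.1 (nb.prune_ssubset hS hT) hTs
      (nb.grow_card T hTt S (nb.prune_rev S hS T hT))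
    exact max_eq_left ((min_le_left _ _).trans (h1.trans hδ1))
  have hZeq : Z = F.card * W + G.card := by
    rw [hZ, Zp, ← Finset.sum_filter_add_sum_filter_not (Np S) (fun T => Sstar ⊆ T),
      Finset.sum_congr rfl hwF, Finset.sum_congr rfl hwG]
    simp
  have hFpos : (1 : ℝ) ≤ F.card := by
    obtain ⟨T, hT, hTs⟩ := nb.prune_toward S hS Sstar hstar hsub
    exact_mod_cast Finset.card_pos.2 ⟨T, Finset.mem_filter.2 ⟨hT, hTs⟩⟩
  have hGle : (G.card : ℝ) ≤ n := by
    exact_mod_cast (Finset.card_le_card (Finset.filter_subset _ _)).trans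
      ((nb.prune_count S hS).trans hLn)
  have hG0 : (0 : ℝ) ≤ G.card := by positivity
  have hFW : W ≤ F.card * W := by nlinarith
  have hZ0 : 0 < Z := by linarith
  have hPF : ∀ T ∈ F, P S T = 1 / 2 * (W / Z) := by
    intro T hT
    have hw := hwF T hT
    obtain ⟨hT, hTs⟩ := Finset.mem_filter.1 hT
    have hTt := nb.prune_tree S hS T hT
    have hss := nb.prune_ssubset hS hT
    have hq := infProp_of_prune (n := n) (c := c) (A := A) (Y := Y) nb hS hT
    have hqr := infProp_reverse_of_prune (n := n) (c := c) (A := A) (Y := Y) nb hS hT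
    rw [hw, ← hZ] at hq
    have hwgle : ∀ U ∈ Ng T, wg L n c A Y T U ≤ W⁻¹ := fun U hU => by
      rw [← hWinv]
      exact (min_le_left _ _).trans (rb.grow_le T hTt U (nb.grow_tree T hTt U hU) hTs
        (nb.grow_ssubset T hTt U hU))
    have hwg : wg L n c A Y T S = postRatio L n c Y T S := by
      refine min_eq_left (le_trans (rb.grow_le T hTt S hS hTs hss) (le_trans ?_ hcap))
      rw [hWinv]
      exact inv_le_one_of_one_le₀ (by linarith)
    have hZg1 : Zg L n c A Y Ng T ≤ 1 := by
      calc Zg L n c A Y Ng T ≤ (Ng T).card • W⁻¹ := Finset.sum_le_card_nsmul _ _ _ hwgle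
        _ = ((Ng T).card : ℝ) * W⁻¹ := nsmul_eq_mul _ _
        _ ≤ n * W⁻¹ := by
          gcongr
          exact_mod_cast (nb.grow_count T hTt).trans hLn
        _ ≤ 1 := by rw [← div_eq_mul_inv]; exact div_le_one_of_le₀ hnW hW0.le
    have hZg0 : 0 < Zg L n c A Y Ng T :=
      Finset.sum_pos (fun U hU => wg_pos hn hc0 hTt (nb.grow_tree T hTt U hU))
        ⟨S, nb.prune_rev S hS T hT⟩
    have hS0 := post_pos (L := L) hn hc0 Y hS
    have hT0 := post_pos (L := L) hn hc0 Y hTt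
    rw [← hq]
    refine mhTrans_eq_of_le hss.ne ?_ ?_
    · rw [hq]; positivity
    · rw [hq, hqr, hwg]
      have e : post L n (splitP n c) Y T * (1 / 2 * (postRatio L n c Y T S / Zg L n c A Y Ng T))
          = post L n (splitP n c) Y S * (1 / 2 * (1 / Zg L n c A Y Ng T)) := by
        rw [postRatio]; field_simp
      rw [e]
      have h1 : W / Z ≤ 1 := div_le_one_of_le₀ (by linarith) hZ0.le
      have h2 : 1 ≤ 1 / Zg L n c A Y Ng T := by rw [one_le_div hZg0]; exact hZg1
      exact mul_le_mul_of_nonneg_left (by linarith) hS0.le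
  have hsumF : ∑ T ∈ F, driftR (V2 L Sstar) S T * P S T
      ≤ -(1 / 2 ^ (L + 2) / (1 + (n : ℝ) ^ (5 / 2 - c))) := by
    have hterm : ∀ T ∈ F, driftR (V2 L Sstar) S T * P S T
        ≤ -(1 / 2 ^ (L + 1)) * (1 / 2 * (W / Z)) := by
      intro T hT
      rw [hPF T hT]
      obtain ⟨hT, hTs⟩ := Finset.mem_filter.1 hT
      have := driftR_prune_le_of_superset (L := L) hTs (nb.prune_ssubset hS hT)
      gcongr
    refine (Finset.sum_le_card_nsmul _ _ _ hterm).trans ?_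
    rw [nsmul_eq_mul, hx]
    have hkey : 1 / (1 + n / W) ≤ F.card * W / Z := by
      rw [div_le_div_iff₀ (by positivity) hZ0, hZeq, one_mul]
      have : (F.card : ℝ) * W * (1 + n / W) = F.card * W + F.card * n := by field_simp
      rw [this]
      nlinarith
    calc (F.card : ℝ) * (-(1 / 2 ^ (L + 1)) * (1 / 2 * (W / Z)))
        = -(1 / 2 ^ (L + 2) * (F.card * W / Z)) := by rw [pow_succ _ (L + 1)]; field_simp
      _ ≤ -(1 / 2 ^ (L + 2) * (1 / (1 + n / W))) := by gcongr
      _ = _ := by rw [mul_one_div]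
  have hsumG : ∑ T ∈ G, driftR (V2 L Sstar) S T * P S T
      ≤ (n : ℝ) ^ (1 - A ^ 2 * Real.log n / 8) := by
    have hterm : ∀ T ∈ G, driftR (V2 L Sstar) S T * P S T ≤ δ := by
      intro T hT
      obtain ⟨hT, hTs⟩ := Finset.mem_filter.1 hT
      have hTt := nb.prune_tree S hS T hT
      have hss := nb.prune_ssubset hS hT
      have hq1 := infProp_nonneg (A := A) (Y := Y) (T := T) nb hn hc0 hS
      have hq2 := infProp_nonneg (A := A) (Y := Y) (T := S) nb hn hc0 hTt
      have hP0 : 0 ≤ P S T := mhTrans_nonneg (L := L) hss.ne (post_pos hn hc0 Y hS).le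
        (post_pos hn hc0 Y hTt).le hq1 hq2
      have hP1 : P S T ≤ _ := mhTrans_le_reverse (L := L) hss.ne (post_pos hn hc0 Y hS).le
        (post_pos hn hc0 Y hTt).le hq1 hq2
      have hr : post L n (splitP n c) Y T / post L n (splitP n c) Y S ≤ δ :=
        rb.drop_le S hS T hTt hsub.1 hss hTs (nb.grow_card T hTt S (nb.prune_rev S hS T hT))
      have hP2 := hP1.trans (mul_le_mul hr
        (infProp_reverse_of_prune_le (A := A) (Y := Y) nb hn hc0 hS hT) hq2 hδ0.le)
      have hR := driftR_prune_le_two hS hsub.1 hss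
      calc _ ≤ 2 * (δ * (1 / 2)) := mul_le_mul hR hP2 hP0 (by norm_num)
        _ = δ := by ring
    calc _ ≤ G.card • δ := Finset.sum_le_card_nsmul _ _ _ hterm
      _ = (G.card : ℝ) * δ := nsmul_eq_mul _ _
      _ ≤ n * δ := by gcongr
      _ = _ := by rw [sub_eq_add_neg, Real.rpow_add hn0, Real.rpow_one]
  rw [← Finset.sum_filter_add_sum_filter_not (Np S) (fun T => Sstar ⊆ T)]
  exact add_le_add hsumF hsumG

end Informed

/-! ## Posterior ratio bounds under the signal-strength assumption -/

lemma log_splitP {n : ℕ} (hn : 0 < n) (c : ℝ) : Real.log (splitP n c) = -c * Real.log n :=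
  Real.log_rpow (by exact_mod_cast hn) _

lemma nodeLog_le {n : ℕ} {c : ℝ} {Y : Fin n → ℝ} {j : ℕ} (hn : 1 < n) (hc : 0 < c)
    (h : colDot n Y j ^ 2 ≤ 4 * n * Real.log n) : nodeLog n c Y j ≤ (3 / 2 - c) * Real.log n := by
  have hn0 : (0 : ℝ) < n := by exact_mod_cast (by omega : 0 < n)
  have hl : 0 ≤ Real.log n := Real.log_natCast_nonneg n
  have h1 : Real.log (1 - splitP n c) ≤ 0 :=
    Real.log_nonpos (sub_pos.2 (splitP_lt_one hn hc)).le
      (by have := splitP_pos (by omega : 0 < n) c; linarith)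
  have h2 : Real.log n ≤ Real.log (1 + n) := Real.log_le_log hn0 (by linarith)
  have h3 : colDot n Y j ^ 2 / (2 * (n + 1)) ≤ 2 * Real.log n := by
    rw [div_le_iff₀ (by positivity)]
    nlinarith
  rw [nodeLog, log_splitP (by omega)]
  linarith

lemma sub_le_nodeLog {n : ℕ} {c s : ℝ} {Y : Fin n → ℝ} {j : ℕ} (hn : 2 ≤ n) (hc : 1 ≤ c)
    (h : s ≤ colDot n Y j ^ 2) :
    s / (2 * (n + 1)) - (c + 2) * Real.log n ≤ nodeLog n c Y j := by
  have hn2 : (2 : ℝ) ≤ n := by exact_mod_cast hn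
  have hn0 : (0 : ℝ) < n := by linarith
  have hp : splitP n c ≤ (n : ℝ)⁻¹ := by
    rw [← Real.rpow_neg_one]
    exact Real.rpow_le_rpow_of_exponent_le (by linarith) (by linarith)
  have hinv : (n : ℝ)⁻¹ ≤ 1 / 2 := by
    rw [inv_eq_one_div]; exact one_div_le_one_div_of_le (by norm_num) hn2
  have h1 : -Real.log n ≤ Real.log (1 - splitP n c) := by
    rw [← Real.log_inv]
    exact Real.log_le_log (by positivity) (by linarith)
  have h2 : Real.log (1 + n) ≤ 2 * Real.log n := by
    rw [← Real.log_rpow hn0]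
    refine Real.log_le_log (by positivity) ?_
    norm_num
    nlinarith
  have h3 : s / (2 * ((n : ℝ) + 1)) ≤ colDot n Y j ^ 2 / (2 * (n + 1)) := by gcongr
  rw [nodeLog, log_splitP (by omega)]
  linarith

lemma signal_colDot_sq {N A ℓ b z : ℝ} (hN : 4 ≤ N) (hℓ : 1 ≤ ℓ) (hA : 54 ≤ A)
    (hb : A * ℓ / √N < |b|) (hz : z ^ 2 ≤ 4 * N * ℓ) :
    A ^ 2 * ℓ ^ 2 / 4 ≤ (N * b + z) ^ 2 / (2 * (N + 1)) := by
  have hs0 : 0 < √N := Real.sqrt_pos.2 (by linarith)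
  have hs : √N ^ 2 = N := Real.sq_sqrt (by linarith)
  have h1 : A * ℓ * √N ≤ |N * b| := by
    rw [div_lt_iff₀ hs0] at hb
    rw [abs_mul, abs_of_nonneg (by linarith : 0 ≤ N)]
    calc A * ℓ * √N ≤ |b| * √N * √N := by gcongr
      _ = N * |b| := by rw [mul_assoc, ← sq, hs, mul_comm]
  have h2 : |z| ≤ 2 * √N * ℓ := by
    refine abs_le_of_sq_le_sq ?_ (by positivity)
    rw [mul_pow, mul_pow, hs]
    nlinarith
  have h3 : (A - 2) * ℓ * √N ≤ |N * b + z| := by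
    have := abs_sub_abs_le_abs_sub (N * b) (-z)
    rw [abs_neg, sub_neg_eq_add] at this
    linarith
  have h4 : ((A - 2) * ℓ * √N) ^ 2 ≤ (N * b + z) ^ 2 := by
    rw [← sq_abs (N * b + z)]
    exact pow_le_pow_left₀ (by have : 0 ≤ A - 2 := by linarith
                               positivity) h3 2
  rw [mul_pow, mul_pow, hs] at h4
  rw [le_div_iff₀ (by linarith)]
  refine le_trans ?_ h4
  have h5 : A ^ 2 * 4 ≤ (A - 2) ^ 2 * 5 := by nlinarith
  have h6 : A ^ 2 / 4 * (2 * (N + 1)) ≤ (A - 2) ^ 2 * N := by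
    nlinarith [mul_nonneg (sq_nonneg A) (by linarith : 0 ≤ N - 4),
      mul_nonneg (by linarith : 0 ≤ N) (sub_nonneg.2 h5)]
  nlinarith [mul_le_mul_of_nonneg_right h6 (sq_nonneg ℓ)]

lemma ratioBounds_of_noise {M L K : ℕ} {c A C : ℝ} {β : ℕ → ℝ} {B Sstar : Finset ℕ}
    {ε : Fin (2 ^ M) → ℝ} (hc : 5 / 2 < c) (hA : 12 * (c + 2) ≤ A) (hM : 2 ≤ M) (hL : L < M)
    (hK : K ≤ M) (ha : Assumption1 L (2 ^ M) A C β B Sstar)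
    (hε : ∀ j < 2 ^ M, colDot (2 ^ M) ε j ^ 2 ≤ 4 * 2 ^ M * Real.log (2 ^ M)) :
    RatioBounds L K (2 ^ M) c A (Yvec (2 ^ M) β B ε) Sstar := by
  have hn4 : 4 ≤ 2 ^ M := (Nat.pow_le_pow_right (by norm_num) hM : 2 ^ 2 ≤ 2 ^ M)
  have hLM : 2 ^ L ≤ 2 ^ M := Nat.pow_le_pow_right (by norm_num) hL.le
  have hdot : ∀ j < 2 ^ M, colDot (2 ^ M) (Yvec (2 ^ M) β B ε) j
      = ((2 ^ M : ℕ) : ℝ) * β j + colDot (2 ^ M) ε j := fun j hj => by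
    rw [colDot_Yvec M j β B ε hj (fun b hb => (ha.B_depth b hb).trans_le hLM) ha.support]
    push_cast; rfl
  have hlog : ((2 ^ M : ℕ) : ℝ) = 2 ^ M := by push_cast; rfl
  rw [← hlog] at hε
  have hlogM : Real.log ((2 ^ M : ℕ) : ℝ) = M * Real.log 2 := by
    rw [hlog, Real.log_pow]
  have hKl : (K : ℝ) ≤ 3 / 2 * Real.log ((2 ^ M : ℕ) : ℝ) := by
    have : (K : ℝ) ≤ M := by exact_mod_cast hK
    rw [hlogM]
    nlinarith [Real.log_two_gt_d9]
  have hl1 : 1 ≤ Real.log ((2 ^ M : ℕ) : ℝ) := by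
    have : (2 : ℝ) ≤ M := by exact_mod_cast hM
    rw [hlogM]
    nlinarith [Real.log_two_gt_d9]
  generalize 2 ^ M = n at *
  have hn4' : (4 : ℝ) ≤ n := by exact_mod_cast hn4
  have hn0 : (0 : ℝ) < n := by linarith
  refine ⟨fun S hS T hT hsub hST => ?_, fun S hS T hT hsub hTS hnot hcard => ?_⟩
  · rw [postRatio_grow (by omega) (by linarith) _ hS hT hST.1, Real.rpow_def_of_pos hn0,
      Real.exp_le_exp, mul_comm]
    have hle : ∀ j ∈ T \ S, nodeLog n c (Yvec n β B ε) j ≤ (3 / 2 - c) * Real.log n := by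
      intro j hj
      obtain ⟨hjT, hjS⟩ := Finset.mem_sdiff.1 hj
      have hjn : j < n := ((mem_trees.1 hT).2.2 j hjT).trans_le hLM
      refine nodeLog_le (by omega) (by linarith) ?_
      rw [hdot j hjn, ha.support j fun h => hjS (hsub (ha.Sstar_contains h)), mul_zero, zero_add]
      exact hε j hjn
    obtain ⟨j, hj⟩ := Finset.sdiff_nonempty.2 hST.2
    have hneg : (3 / 2 - c) * Real.log n ≤ 0 :=
      mul_nonpos_of_nonpos_of_nonneg (by linarith) (by linarith)
    rw [← Finset.add_sum_erase _ _ hj]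
    have := Finset.sum_nonpos fun i (hi : i ∈ (T \ S).erase j) =>
      (hle i (Finset.mem_of_mem_erase hi)).trans hneg
    linarith [hle j hj]
  · obtain ⟨b, hbB, hbT⟩ : ∃ b ∈ B, b ∉ T := by
      by_contra! h
      exact hnot (ha.Sstar_min T hT h)
    have hb : b ∈ S \ T := Finset.mem_sdiff.2 ⟨hsub (ha.Sstar_contains hbB), hbT⟩
    have hbn : b < n := (ha.B_depth b hbB).trans_le hLM
    have hlow : ∀ j ∈ S \ T, -((c + 2) * Real.log n) ≤ nodeLog n c (Yvec n β B ε) j := by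
      intro j _
      simpa using sub_le_nodeLog (s := 0) (c := c) (by omega) (by linarith)
        (sq_nonneg (colDot n (Yvec n β B ε) j))
    have hbl : A ^ 2 * Real.log n ^ 2 / 4 - (c + 2) * Real.log n
        ≤ nodeLog n c (Yvec n β B ε) b := by
      have h1 := sub_le_nodeLog (c := c) (j := b) (Y := Yvec n β B ε) (by omega) (by linarith)
        le_rfl
      have h2 := signal_colDot_sq hn4' hl1 (by linarith) (ha.signal_low b hbB) (hε b hbn)
      rw [← hdot b hbn] at h2
      linarith
    rw [postRatio_prune (by omega) (by linarith) _ hS hT hTS.1, Real.rpow_def_of_pos hn0,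
      Real.exp_le_exp, ← Finset.add_sum_erase _ _ hb]
    have h3 := Finset.card_nsmul_le_sum ((S \ T).erase b) _ _ fun i hi => hlow i (Finset.mem_of_mem_erase hi)
    rw [nsmul_eq_mul] at h3
    have h4 : (((S \ T).erase b).card : ℝ) + 1 ≤ K := by
      exact_mod_cast (Finset.card_erase_add_one hb).le.trans hcard
    have h5 : (((S \ T).erase b).card + 1 : ℝ) * ((c + 2) * Real.log n)
        ≤ A ^ 2 * Real.log n ^ 2 / 8 := by
      calc (((S \ T).erase b).card + 1 : ℝ) * ((c + 2) * Real.log n)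
          ≤ 3 / 2 * Real.log n * ((c + 2) * Real.log n) := by
            have : 0 ≤ c + 2 := by linarith
            gcongr
            linarith
        _ = 12 * (c + 2) * (Real.log n ^ 2 / 8) := by ring
        _ ≤ A ^ 2 * (Real.log n ^ 2 / 8) := by
            gcongr
            nlinarith
        _ = _ := by ring
    nlinarith

/-- **Lemma (Drift ratio sums at overfitted trees for informed chains).**
Under the assumptions of the informed-mixing theorem, with probability at least
`1 − 4/n − e^{−n/8}` over `ε ~ N(0, I_n)`, for every overfitted tree `𝒯 ⊋ 𝒯*`:
`Σ_{𝒯̃∈𝒩_p(𝒯)} R₂(𝒯,𝒯̃)P(𝒯,𝒯̃) ≤ −2^{−(L+2)}/(1+n^{5/2−c}) + n^{1−(A²log n)/8}` and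
`Σ_{𝒯̃∈𝒩_g(𝒯)} R₂(𝒯,𝒯̃)P(𝒯,𝒯̃) ≤ M/n^{c−3/2}`, with `M = 1` for the informed
Bayesian CART and `M = 2L` for the informed Twiggy Bayesian CART. -/
theorem informed_drift_sums_overfitted (c : ℝ) (hc : 5 / 2 < c) :
    ∃ (A₀ : ℝ) (N : ℕ), 0 < A₀ ∧ ∀ A ≥ A₀,
      ∀ (Lmax L n : ℕ), n = 2 ^ (Lmax + 1) → L ≤ Lmax → N ≤ n →
      ∀ (C : ℝ) (β : ℕ → ℝ) (B Sstar : Finset ℕ), Assumption1 L n A C β B Sstar →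
      ENNReal.ofReal (1 - 4 / n - Real.exp (-(n : ℝ) / 8)) ≤
        gauss n {ε | ∀ S ∈ trees L, Sstar ⊆ S → S ≠ Sstar →
          (∑ T ∈ bNp S, driftR (V2 L Sstar) S T *
              infBcartP L n c A (Yvec n β B ε) S T ≤
            -(1 / 2 ^ (L + 2) / (1 + (n : ℝ) ^ (5 / 2 - c)))
              + (n : ℝ) ^ (1 - A ^ 2 * Real.log n / 8)) ∧
          (∑ T ∈ bNg L S, driftR (V2 L Sstar) S T *
              infBcartP L n c A (Yvec n β B ε) S T ≤ 1 / (n : ℝ) ^ (c - 3 / 2)) ∧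
          (∑ T ∈ tNp S, driftR (V2 L Sstar) S T *
              infTwiggyP L n c A (Yvec n β B ε) S T ≤
            -(1 / 2 ^ (L + 2) / (1 + (n : ℝ) ^ (5 / 2 - c)))
              + (n : ℝ) ^ (1 - A ^ 2 * Real.log n / 8)) ∧
          (∑ T ∈ tNg L S, driftR (V2 L Sstar) S T *
              infTwiggyP L n c A (Yvec n β B ε) S T ≤ 2 * L / (n : ℝ) ^ (c - 3 / 2))} := by
  refine ⟨12 * (c + 2), 4, by linarith, ?_⟩
  rintro A hA Lmax L n rfl hL hN C β B Sstar ha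
  have hc0 : 0 < c := by linarith
  have hn : 1 < 2 ^ (Lmax + 1) := by omega
  have hLn : 2 ^ L ≤ 2 ^ (Lmax + 1) := Nat.pow_le_pow_right (by norm_num) (by omega)
  have hM : 2 ≤ Lmax + 1 := by
    by_contra! h
    have : 2 ^ (Lmax + 1) ≤ 2 ^ 1 := Nat.pow_le_pow_right (by norm_num) (by omega)
    omega
  refine (ENNReal.ofReal_le_ofReal ?_).trans
    ((gauss_noise_event (Lmax + 1)).trans (measure_mono fun ε hε => ?_))
  · have h1 : 2 / (2 : ℝ) ^ (Lmax + 1) ≤ 4 / 2 ^ (Lmax + 1) := by gcongr; norm_num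
    have h2 := Real.exp_pos (-((2 ^ (Lmax + 1) : ℕ) : ℝ) / 8)
    push_cast at h2 ⊢
    linarith
  · intro S hS hsub hne
    have hss : Sstar ⊂ S := hsub.ssubset_of_ne hne.symm
    have rb : ∀ K ≤ Lmax + 1,
        RatioBounds L K (2 ^ (Lmax + 1)) c A (Yvec (2 ^ (Lmax + 1)) β B ε) Sstar :=
      fun K hK => ratioBounds_of_noise hc hA hM (by omega) hK ha hε
    have rb1 := rb 1 (by omega)
    have rbL := rb L (by omega)
    have nb1 := isTwigNbhd_bcart L
    have nbL := isTwigNbhd_twiggy L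
    refine ⟨prune_drift_sum_le nb1 ha.Sstar_tree rb1 hn hc hLn hS hss, ?_,
      prune_drift_sum_le nbL ha.Sstar_tree rbL hn hc hLn hS hss, ?_⟩
    · rw [← Nat.cast_one (R := ℝ)]
      exact grow_drift_sum_le nb1 rb1 hn hc0 Nat.one_le_two_pow hS hsub
    · refine (grow_drift_sum_le nbL rbL hn hc0 Nat.lt_two_pow_self.le hS hsub).trans ?_
      gcongr
      have : (0 : ℝ) ≤ L := by positivity
      linarith

end BayesCART
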